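/- 0.195 < V(3,6) < 0.196; that is, the maximal volume of a 6-vertex polytope of unit diameter in ℝ³ lies strictly between 0.195 and 0.196. -/

import Mathlib

open MeasureTheory Metric Set

/-- `polyVol n k` is the supremum, over all sets `S` of `k` points in Euclidean `n`-space
whose diameter is at most 1, of the `n`-dimensional Lebesgue measure of the convex hull
of `S`. -/
noncomputable def polyVol (n k : ℕ) : ℝ :=
  sSup {v : ℝ | ∃ S : Finset (EuclideanSpace ℝ (Fin n)),
    S.card = k ∧ Metric.diam (S : Set (EuclideanSpace ℝ (Fin n))) ≤ 1 ∧
    v = (volume (convexHull ℝ (S : Set (EuclideanSpace ℝ (Fin n))))).toReal}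



lemma le_of_sq_aux {a b : ℝ} (h : a^2 ≤ b^2) (hb : 0 ≤ b) : a ≤ b :=
  (le_abs_self a).trans (abs_le_of_sq_le_sq h hb)

lemma cs2 {a b c d A B : ℝ} (h1 : a^2+b^2 ≤ A^2) (h2 : c^2+d^2 = B^2) (hA : 0 ≤ A) (hB : 0 ≤ B) :
    a*c+b*d ≤ A*B := by
  apply le_of_sq_aux _ (mul_nonneg hA hB)
  have h3 : (a*c+b*d)^2 ≤ (a^2+b^2)*(c^2+d^2) := by nlinarith only [sq_nonneg (a*d-b*c)]
  rw [mul_pow, ← h2]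
  exact h3.trans (mul_le_mul_of_nonneg_right h1 (by positivity))

lemma exists_sqrt_aux {a : ℝ} (h : 0 ≤ a) : ∃ r : ℝ, 0 ≤ r ∧ r^2 = a :=
  ⟨√a, Real.sqrt_nonneg _, Real.sq_sqrt h⟩

/-- pentagram-like case -/
lemma core_A (x y s m1 M e1 e2 : ℝ)
    (hm1 : m1^2+M^2+x^2+y^2+2*(m1*x+M*y) ≤ 3/4) (hm2 : m1^2+M^2+x^2+y^2-2*(m1*x+M*y) ≤ 3/4)
    (he1 : e1^2+e2^2+s^2+2*e1*s ≤ 1)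
    (hW : (s-x)^2+y^2 ≤ 1/4) (hn : x^2+y^2 ≤ 1/4) (hs : 0 ≤ s) (hy : 0 ≤ y)
    (hbc : 0 ≤ M*x-m1*y) (hA : x*(s-x) < y^2) :
    m1*y+M*(s-x)+e1*y+e2*x ≤ 0.5 := by
  obtain ⟨ν, hν0, hν⟩ := exists_sqrt_aux (add_nonneg (sq_nonneg x) (sq_nonneg y))
  have hνpos : 0 < ν := by
    rcases hν0.lt_or_eq with h | h
    · exact h
    · exfalso
      rw [← h] at hν
      have h1 : x = 0 := by nlinarith only [hν, sq_nonneg x, sq_nonneg y]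
      have h2 : y = 0 := by nlinarith only [hν, sq_nonneg x, sq_nonneg y]
      subst h1 h2
      simp at hA
  have hνh : ν ≤ 1/2 := by nlinarith only [hν, hn, hν0]
  obtain ⟨r, hr0, hr⟩ := exists_sqrt_aux (show (0:ℝ) ≤ 3/4 by norm_num)
  have hr1 : r ≤ 1 := by nlinarith only [hr, hr0]
  have hr2 : 1/2 ≤ r := by nlinarith only [hr, hr0]
  -- e-term
  have hE : e1*y+e2*x ≤ ν - s*y := by
    have := cs2 (a := e1+s) (b := e2) (c := y) (d := x) (A := 1) (B := ν)
      (by linarith) (by linarith) zero_le_one hν0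
    linarith
  -- m·n
  obtain ⟨D, hD⟩ : ∃ D, D = m1*x+M*y := ⟨_, rfl⟩
  rw [← hD] at hm1 hm2
  have hDn : D^2 ≤ ν^2*(m1^2+M^2) := by
    rw [hν, hD]; nlinarith only [sq_nonneg (m1*y-M*x)]
  have hDabs : |D| ≤ ν*(r-ν) := by
    have h1 : (|D|/ν)^2 ≤ m1^2+M^2 := by
      rw [div_pow, sq_abs, div_le_iff₀ (by positivity)]; linarith
    have h2 : m1^2+M^2+ν^2+2*|D| ≤ r^2 := by
      rcases abs_cases D with h | h <;> rw [hν, hr] <;> linarith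
    have h3 : (|D|/ν+ν)^2 ≤ r^2 := by
      have : 2*(|D|/ν)*ν = 2*|D| := by field_simp
      linarith [add_sq (|D|/ν) ν]
    have h4 := le_of_sq_aux h3 hr0
    have h5 : |D|/ν ≤ r-ν := by linarith
    rw [div_le_iff₀ hνpos] at h5
    linarith
  have hid : ν^2*(m1*y+M*(s-x)) = D*(s*y) - (M*x-m1*y)*(y^2-x*(s-x)) := by
    rw [hν, hD]; ring
  have hsy0 : 0 ≤ s*y := by positivity
  have hM : ν^2*(m1*y+M*(s-x)) ≤ ν*(r-ν)*(s*y) := by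
    rw [hid]
    have h1 : 0 ≤ (M*x-m1*y)*(y^2-x*(s-x)) := mul_nonneg hbc (by linarith)
    have h2 : D*(s*y) ≤ ν*(r-ν)*(s*y) :=
      mul_le_mul_of_nonneg_right ((le_abs_self D).trans hDabs) hsy0
    linarith
  have hsy : s*y ≤ (1/2)*ν := by
    have := cs2 (a := y) (b := s-x) (c := x) (d := y) (A := 1/2) (B := ν)
      (by linarith) (by linarith) (by norm_num) hν0
    linarith
  have hM' : ν*(m1*y+M*(s-x)) ≤ (r-ν)*(s*y) := by
    have : ν*(ν*(m1*y+M*(s-x))) ≤ ν*((r-ν)*(s*y)) := by linarith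
    exact le_of_mul_le_mul_left this hνpos
  have : ν*(m1*y+M*(s-x)+e1*y+e2*x) ≤ ν*0.5 := by
    have h1 : ν*(e1*y+e2*x) ≤ ν*(ν-s*y) := mul_le_mul_of_nonneg_left hE hν0
    have h2 : ν*(m1*y+M*(s-x)+e1*y+e2*x) ≤ ν^2 + (s*y)*(r-2*ν) := by linarith
    rcases le_total 0 (r-2*ν) with h | h
    · nlinarith only [h2, hr1, hν0, hνpos, mul_le_mul_of_nonneg_right hsy h]
    · nlinarith only [h2, hνh, hν0, mul_nonneg hsy0 (neg_nonneg.2 h)]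
  exact le_of_mul_le_mul_left this hνpos

lemma P1 (x q : ℝ) (hx : 0 ≤ x) (hq : 0 ≤ q) (hx2 : x ≤ 1/2) (hq2 : q ≤ 1/2) : (50/81)*(3/4+6561/10000-x^2)*q+x*(50/59*(1+3481/10000-(x+q)^2)) ≤ 5877/10000 := by
  rcases le_total x (9/20) with h | h
  · have hA : (50/81)*(3/4+6561/10000-x^2)*(1/2)+x*(50/59*(1+3481/10000-(x+1/2)^2)) ≤ 5877/10000 := by
      nlinarith only [mul_nonneg hx (sq_nonneg (x-308/1000)), sq_nonneg (x-308/1000), hx, hx2]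
    have hg : 0 ≤ (50/81)*(3/4+6561/10000-x^2) - 2*x*(x+1/2)*(50/59) := by nlinarith only [hx, h]
    have := mul_nonneg (sub_nonneg.2 hq2) hg
    have h3 := mul_nonneg hx (sq_nonneg (1/2-q))
    linarith
  · have hA' : (50/81)*(3/4+6561/10000-x^2)*(1/2)+x*(50/59*(1+3481/10000-(x+1/2)^2)) ≤ 545/1000 := by
      nlinarith only [mul_nonneg hx (sq_nonneg (x-45/100)), sq_nonneg (x-45/100), hx, hx2, h]
    have hg : -17/100 ≤ (50/81)*(3/4+6561/10000-x^2) - 2*x*(x+1/2)*(50/59) := by nlinarith only [hx, h, hx2]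
    have := mul_le_mul_of_nonneg_left hg (sub_nonneg.2 hq2)
    have h3 : 45/100*(1/2-q)^2 ≤ x*(1/2-q)^2 := mul_le_mul_of_nonneg_right (by linarith) (sq_nonneg _)
    have h4 := sq_nonneg (1/2-q - 22/100)
    linarith

lemma P2a (x q y : ℝ) (hx : 0 ≤ x) (hq : 0 ≤ q) (hy : 0 ≤ y) (hx2 : x ≤ 1/2) (hq2 : q ≤ 39/100) (h6 : q*x ≤ 867/1000*y)  (hy2 : y^2 ≤ x*q) :  867/1000*((q^2+y^2+9/100)*(5/3)) - y*(x+q)+x*((1-(x+q)^2+16/25)*(5/8)) ≤ 5877/10000 := by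
  have h1 : 2*y ≤ x+q := by
    apply abs_le_of_sq_le_sq' _ (by linarith) |>.2
    nlinarith only [hy2, sq_nonneg (x-q)]
  have h2 : y^2 ≤ y*(x+q)/2 := by nlinarith only [h1, hy]
  have h3 : q*x*(x+q) ≤ 867/1000*y*(x+q) := mul_le_mul_of_nonneg_right h6 (by linarith)
  have h4 : 1445/1000*(q^2+9/100) - 32/100*(q*x*(x+q)) + x*((1-(x+q)^2+16/25)*(5/8)) ≤ 5877/10000 := by
    nlinarith only [hx, hq, hx2, hq2, mul_nonneg hx hq, mul_nonneg (sub_nonneg.2 hx2) (sub_nonneg.2 hq2), mul_nonneg hx (sub_nonneg.2 hq2), mul_nonneg hq (sub_nonneg.2 hq2), mul_nonneg hx (sub_nonneg.2 hx2), mul_nonneg (mul_nonneg hx hq) (sub_nonneg.2 hq2), mul_nonneg hx (sq_nonneg (x-45/100)), sq_nonneg (x-45/100), mul_nonneg (mul_nonneg hx hq) (sub_nonneg.2 hx2), mul_nonneg (mul_nonneg hx (sub_nonneg.2 hq2)) (sub_nonneg.2 hx2)]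
  have h5 : 0 ≤ y*(x+q) := by positivity
  nlinarith only [h2, h3, h4, h5]
lemma P2b (x q y : ℝ) (hx : 0 ≤ x) (hq : 39/100 ≤ q) (hy : 0 ≤ y) (hx2 : x ≤ 1/2) (h6 : q*x ≤ 867/1000*y) :  4335/10000 - y*(x+q)+x*((1-(x+q)^2+16/25)*(5/8)) ≤ 5877/10000 := by
  have h3 : q*x*(x+q) ≤ 867/1000*y*(x+q) := mul_le_mul_of_nonneg_right h6 (by linarith)
  have h7 : 39/100*x*(x+39/100) ≤ q*x*(x+q) := by gcongr
  have h8 : x*(x+39/100)^2 ≤ x*(x+q)^2 := by gcongr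
  nlinarith only [hx, hx2, h3, h7, h8, mul_nonneg hx (sq_nonneg (x-35/100)), sq_nonneg (x-35/100)]

lemma core_poly1 (x q R ε : ℝ) (hx : 0 ≤ x) (hq : 0 ≤ q) (hx2 : x ≤ 1/2) (hq2 : q ≤ 1/2)
    (hR : R^2 = 3/4 - x^2) (hε : ε^2 = 1-(x+q)^2) : R*q+x*ε ≤ 5877/10000 := by
  have h1 : R ≤ (50/81)*(3/4+6561/10000-x^2) := by
    nlinarith only [hR, sq_nonneg (R-81/100)]
  have h2 : ε ≤ 50/59*(1+3481/10000-(x+q)^2) := by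
    nlinarith only [hε, sq_nonneg (ε-59/100)]
  have h3 := mul_le_mul_of_nonneg_right h1 hq
  have h4 := mul_le_mul_of_nonneg_left h2 hx
  have h5 := P1 x q hx hq hx2 hq2
  linarith

lemma core_poly2 (x q y r ε w : ℝ) (hx : 0 ≤ x) (hq : 0 ≤ q) (hy : 0 ≤ y) (hx2 : x ≤ 1/2)
    (hw : w^2 = q^2+y^2) (hr0 : 0 ≤ r) (hr : r^2=3/4) (hy2 : y^2 ≤ x*q) (hyl : q*x ≤ r*y)
    (hW : q^2+y^2 ≤ 1/4)
    (hε : ε^2 = 1-(x+q)^2) : r*w - y*(x+q)+x*ε ≤ 5877/10000 := by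
  have h1 : w ≤ (q^2+y^2+9/100)*(5/3) := by
    nlinarith only [hw, sq_nonneg (w-3/10)]
  have h2 : ε ≤ (1-(x+q)^2+16/25)*(5/8) := by
    nlinarith only [hε, sq_nonneg (ε-4/5)]
  have hr1 : r ≤ 867/1000 := by nlinarith only [hr, hr0]
  have h4 := mul_le_mul_of_nonneg_left h2 hx
  have h6 : q*x ≤ 867/1000*y := hyl.trans (mul_le_mul_of_nonneg_right hr1 hy)
  rcases le_total q (39/100) with hq3 | hq3
  · have h3 := mul_le_mul_of_nonneg_left h1 hr0
    have h5 := P2a x q y hx hq hy hx2 hq3 h6 hy2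
    have h7 : r*((q^2+y^2+9/100)*(5/3)) ≤ 867/1000*((q^2+y^2+9/100)*(5/3)) :=
      mul_le_mul_of_nonneg_right hr1 (by positivity)
    linarith
  · have h5 := P2b x q y hx hq3 hy hx2 h6
    have hw2 : w ≤ 1/2 := le_of_sq_aux (by linarith) (by norm_num)
    have h3 := mul_le_mul_of_nonneg_left hw2 hr0
    linarith

lemma core_B (x y s q m1 M e1 e2 : ℝ) (hsq : s = x+q)
    (hm1 : m1^2+M^2+x^2+y^2+2*(m1*x+M*y) ≤ 3/4) (hm2 : m1^2+M^2+x^2+y^2-2*(m1*x+M*y) ≤ 3/4)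
    (he1 : e1^2+e2^2+s^2+2*e1*s ≤ 1) (he2 : e1^2+e2^2+s^2-2*e1*s ≤ 1)
    (hW : q^2+y^2 ≤ 1/4) (hn : x^2+y^2 ≤ 1/4) (hs : 0 ≤ s) (hy : 0 ≤ y)
    (hB : y^2 ≤ x*q) :
    m1*y+M*q+e1*y+e2*x ≤ 5877/10000 := by
  have hxh : x ≤ 1/2 := by nlinarith only [hn, sq_nonneg y]
  have hqh : q ≤ 1/2 := by nlinarith only [hW, sq_nonneg y]
  have hx : 0 ≤ x := by
    by_contra h
    push Not at h
    have : 0 < q := by linarith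
    nlinarith only [h, this, hB, sq_nonneg y]
  have hq : 0 ≤ q := by
    by_contra h
    push Not at h
    have : 0 < x := by linarith
    nlinarith only [h, this, hB, sq_nonneg y]
  obtain ⟨r, hr0, hr⟩ := exists_sqrt_aux (show (0:ℝ) ≤ 3/4 by norm_num)
  obtain ⟨ν, hν0, hν⟩ := exists_sqrt_aux (add_nonneg (sq_nonneg x) (sq_nonneg y))
  obtain ⟨w, hw0, hw⟩ := exists_sqrt_aux (add_nonneg (sq_nonneg q) (sq_nonneg y))
  obtain ⟨R, hR0, hR⟩ := exists_sqrt_aux (show (0:ℝ) ≤ 3/4-x^2 by nlinarith only [hn, sq_nonneg y])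
  have hs1 : s^2 ≤ 1 := by nlinarith only [he1, he2, sq_nonneg e1, sq_nonneg e2]
  obtain ⟨ε, hε0, hε⟩ := exists_sqrt_aux (show (0:ℝ) ≤ 1-s^2 by linarith)
  have hRpos : 0 < R := by nlinarith only [hR, hR0, hx, hxh]
  -- M2
  have hM2 : m1*y+M*q ≤ r*w - y*s := by
    have := cs2 (a := m1+x) (b := M+y) (c := y) (d := q) (A := r) (B := w)
      (by linarith) (by linarith) hr0 hw0
    rw [hsq]; linarith
  -- E2
  have hE2 : e1*y+e2*x ≤ ν - s*y := by
    have := cs2 (a := e1+s) (b := e2) (c := y) (d := x) (A := 1) (B := ν)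
      (by linarith) (by linarith) zero_le_one hν0
    linarith
  rcases le_total (y*ε) (x*s) with hE | hE
  · have hE1 : e1*y+e2*x ≤ x*ε := by
      rcases le_total e1 0 with h | h
      · have h1 : e2 ≤ ε := by
          apply le_of_sq_aux _ hε0
          linarith [sq_nonneg e1]
        nlinarith only [h, h1, hx, hy]
      · have h1 : e2*ε ≤ ε^2 - e1*s := by nlinarith only [he1, hε, sq_nonneg (e2-ε), sq_nonneg e1]
        rcases hε0.lt_or_eq with h0 | h0
        · have h2 : (e1*y+e2*x)*ε ≤ x*ε*ε := by
            have := mul_le_mul_of_nonneg_left h1 hx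
            have h3 := mul_le_mul_of_nonneg_left hE h
            linarith
          exact le_of_mul_le_mul_right h2 h0
        · rw [← h0] at hε ⊢
          have hs2 : s = 1 := by nlinarith only [hs, hε]
          rw [hs2] at he1
          have h4 : e1 = 0 := by nlinarith only [he1, h, sq_nonneg e1, sq_nonneg e2]
          have h5 : e2 = 0 := by nlinarith only [he1, h, sq_nonneg e1, sq_nonneg e2]
          rw [h4, h5]; simp
    rcases le_total (q*x) (R*y) with hM | hM
    · have := core_poly2 x q y r ε w hx hq hy hxh hw hr0 hr hB (by
        have : R ≤ r := le_of_sq_aux (by linarith [sq_nonneg x]) hr0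
        exact hM.trans (mul_le_mul_of_nonneg_right this hy)) hW (by rw [← hsq]; exact hε)
      rw [hsq] at hM2
      linarith
    · have hM1 : m1*y+M*q ≤ R*q := by
        rcases le_total m1 0 with h | h
        · have h1 : M ≤ R := le_of_sq_aux (by linarith [sq_nonneg m1, sq_nonneg y]) hR0
          nlinarith only [h, h1, hq, hy]
        · have h1 : (M+y)*R ≤ R^2 - m1*x := by
            nlinarith only [hm1, hR, sq_nonneg (M+y-R), sq_nonneg m1]
          have h2 : (m1*y+M*q)*R ≤ R*q*R := by
            have := mul_le_mul_of_nonneg_left h1 hq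
            have h3 := mul_le_mul_of_nonneg_left hM h
            linarith [mul_nonneg (mul_nonneg hy hR0) hq]
          exact le_of_mul_le_mul_right h2 hRpos
      have := core_poly1 x q R ε hx hq hxh hqh hR (by rw [← hsq]; exact hε)
      linarith
  · -- E1 fails
    have hw2 : w ≤ 1/2 := le_of_sq_aux (by linarith) (by norm_num)
    have hν2 : ν ≤ 1/2 := le_of_sq_aux (by linarith) (by norm_num)
    have hr1 : r ≤ 0.8661 := by nlinarith only [hr, hr0]
    have hys : s*ν ≤ y := by
      apply le_of_sq_aux _ hy
      have h1 : (x*s)^2 ≤ (y*ε)^2 := pow_le_pow_left₀ (by positivity) hE 2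
      rw [mul_pow, mul_pow, hε] at h1
      rw [mul_pow, hν]; linarith
    have hP : m1*y+M*q+e1*y+e2*x ≤ r*w + ν*(1-2*s^2) := by
      have := mul_le_mul_of_nonneg_left hys hs
      linarith
    rcases le_total 0.6 s with h6 | h6
    · have h7 : 1-2*s^2 ≤ 0.28 := by nlinarith only [h6]
      have h8 : ν*(1-2*s^2) ≤ 1/2*0.28 :=
        (mul_le_mul_of_nonneg_left h7 hν0).trans (mul_le_mul_of_nonneg_right hν2 (by norm_num))
      have h9 : r*w ≤ 0.8661*(1/2) := mul_le_mul hr1 hw2 hw0 (by norm_num)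
      linarith
    · have hws : w^2+ν^2 ≤ s^2 := by
        rw [hw, hν, hsq]; linarith
      obtain ⟨w', hw'0, hw'⟩ := exists_sqrt_aux (show (0:ℝ) ≤ s^2-ν^2 by linarith [sq_nonneg w])
      have h1 : w ≤ w' := le_of_sq_aux (by linarith) hw'0
      obtain ⟨z, hz0, hz⟩ := exists_sqrt_aux (show (0:ℝ) ≤ r^2+(1-2*s^2)^2 by positivity)
      have h2 := cs2 (a := w') (b := ν) (c := r) (d := 1-2*s^2) (A := s) (B := z)
        (by linarith) (by linarith) hs hz0
      have h3 : s*z ≤ 0.55 := by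
        apply le_of_sq_aux _ (by norm_num)
        rw [mul_pow, hz, hr]
        obtain ⟨T, hT⟩ : ∃ T, T = s^2 := ⟨_, rfl⟩
        rw [← hT]
        have hT0 : 0 ≤ T := hT ▸ sq_nonneg s
        have hT1 : T ≤ 0.36 := by rw [hT]; nlinarith only [h6, hs]
        nlinarith only [hT0, hT1, mul_nonneg hT0 (sub_nonneg.2 hT1), mul_nonneg (mul_nonneg hT0 hT0) (sub_nonneg.2 hT1)]
      have h4 := mul_le_mul_of_nonneg_left h1 hr0
      linarith

lemma core_planar (x y s m1 M e1 e2 : ℝ)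
    (hm1 : m1^2+M^2+x^2+y^2+2*(m1*x+M*y) ≤ 3/4) (hm2 : m1^2+M^2+x^2+y^2-2*(m1*x+M*y) ≤ 3/4)
    (he1 : e1^2+e2^2+s^2+2*e1*s ≤ 1) (he2 : e1^2+e2^2+s^2-2*e1*s ≤ 1)
    (hW : (s-x)^2+y^2 ≤ 1/4) (hn : x^2+y^2 ≤ 1/4) (hs : 0 ≤ s)
    (hbc : 0 ≤ M*x-m1*y) :
    m1*y+M*(s-x)+e1*y+e2*x ≤ 5877/10000 := by
  rcases le_total 0 y with hy | hy
  · rcases lt_or_ge (x*(s-x)) (y^2) with h | h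
    · have := core_A x y s m1 M e1 e2 hm1 hm2 he1 hW hn hs hy hbc h
      linarith
    · exact core_B x y s (s-x) m1 M e1 e2 (by ring) hm1 hm2 he1 he2 hW hn hs hy h
  · rcases lt_or_ge (x*(s-x)) (y^2) with h | h
    · have := core_A x (-y) s (-m1) M (-e1) e2 (by linarith) (by linarith) (by linarith)
        (by linarith) (by linarith) hs (by linarith) (by linarith) (by linarith)
      linarith
    · have := core_B x (-y) s (s-x) (-m1) M (-e1) e2 (by ring) (by linarith) (by linarith)
        (by linarith) (by linarith) (by linarith) (by linarith) hs (by linarith) (by linarith)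
      linarith

/-- scaling lemma for the m-vectors -/
lemma scale_m (t B1 B2 n1 n2 : ℝ) (ht0 : 0 ≤ t) (ht1 : t ≤ 1) (hB : B1^2+B2^2 ≤ 1-t^2/4)
    (hn : n1^2+n2^2 ≤ 1/4) : (t*B1+(1-t)*n1)^2+(t*B2+(1-t)*n2)^2 ≤ 3/4 := by
  obtain ⟨r, hr0, hr⟩ := exists_sqrt_aux (show (0:ℝ) ≤ 1-t^2/4 by nlinarith only [ht0, ht1])
  obtain ⟨ν, hν0, hν⟩ := exists_sqrt_aux (add_nonneg (sq_nonneg n1) (sq_nonneg n2))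
  obtain ⟨k, hk0, hk⟩ := exists_sqrt_aux (show (0:ℝ) ≤ 3 by norm_num)
  have hν2 : ν ≤ 1/2 := le_of_sq_aux (by linarith) (by norm_num)
  have h1 := cs2 (a := B1) (b := B2) (c := n1) (d := n2) (A := r) (B := ν)
    (by linarith) (by linarith) hr0 hν0
  have h2 : B1*n1+B2*n2 ≤ r*(1/2) := h1.trans (mul_le_mul_of_nonneg_left hν2 hr0)
  have h3 : (t*B1+(1-t)*n1)^2+(t*B2+(1-t)*n2)^2 ≤ (t*r+(1-t)/2)^2 := by
    have a1 := mul_le_mul_of_nonneg_left h2 (mul_nonneg ht0 (sub_nonneg.2 ht1))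
    have a2 := mul_le_mul_of_nonneg_left hB (sq_nonneg t)
    have a3 := mul_le_mul_of_nonneg_left hn (sq_nonneg (1-t))
    rw [← hr] at a2
    linarith
  have hk2 : k ≤ 2 := by nlinarith only [hk, hk0]
  have h4 : t*r+(1-t)/2 ≤ k/2 := by
    have hkpos : 0 < k := by nlinarith only [hk, hk0]
    have b1 : r*k ≤ 7/4-t^2/4 := by nlinarith only [hr, hk, sq_nonneg (r-k/2)]
    have b2 : (t*r+(1-t)/2)*k ≤ k/2*k := by
      have := mul_le_mul_of_nonneg_left b1 ht0
      have b3 := mul_le_mul_of_nonneg_left hk2 (sub_nonneg.2 ht1)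
      have b4 : 0 ≤ (1-t)*(2-t-t^2) := mul_nonneg (by linarith) (by nlinarith only [ht0, ht1])
      nlinarith only [this, b3, b4, hk]
    exact le_of_mul_le_mul_right b2 hkpos
  have h5 : 0 ≤ t*r+(1-t)/2 := add_nonneg (mul_nonneg ht0 hr0) (by linarith)
  have h6 : (t*r+(1-t)/2)^2 ≤ (k/2)^2 := pow_le_pow_left₀ h5 h4 2
  have h7 : (k/2)^2 = 3/4 := by rw [div_pow, hk]; norm_num
  linarith

lemma scale_e (t Y1 Y2 s1 s2 : ℝ) (ht0 : 0 ≤ t) (ht1 : t ≤ 1) (hY : Y1^2+Y2^2 ≤ 1)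
    (hs : s1^2+s2^2 ≤ 1) : (t*Y1+(1-t)*s1)^2+(t*Y2+(1-t)*s2)^2 ≤ 1 := by
  have h1 : Y1*s1+Y2*s2 ≤ 1 := by nlinarith only [hY, hs, sq_nonneg (Y1-s1), sq_nonneg (Y2-s2)]
  have a1 := mul_le_mul_of_nonneg_left h1 (mul_nonneg ht0 (sub_nonneg.2 ht1))
  have a2 := mul_le_mul_of_nonneg_left hY (sq_nonneg t)
  have a3 := mul_le_mul_of_nonneg_left hs (sq_nonneg (1-t))
  linarith

/-- planar version in terms of `m,n,e,s` -/
lemma planar2 (t m1 m2 n1 n2 e1 e2 s : ℝ) (ht0 : 0 < t) (ht1 : t ≤ 1)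
    (hB : (m1+n1)^2+(m2+n2)^2 ≤ 1-t^2/4) (hC : (m1-n1)^2+(m2-n2)^2 ≤ 1-t^2/4)
    (hX : (s-e1)^2+e2^2 ≤ 1) (hY : (s+e1)^2+e2^2 ≤ 1) (hn : n1^2+n2^2 ≤ 1/4)
    (hW : (s+n1)^2+n2^2 ≤ 1/4) (hs : 0 ≤ s) (hbc : m1*n2-m2*n1 ≤ 0) :
    t*(2*(m1*n2-m2*(s+n1))+2*(e1*n2-e2*n1)) ≤ 11754/10000 := by
  have hs2 : s^2+0^2 ≤ 1 := by nlinarith only [hX, hY, sq_nonneg e1, sq_nonneg e2]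
  have h1 := scale_m t (m1+n1) (m2+n2) n1 n2 ht0.le ht1 hB hn
  have h2 := scale_m t (m1-n1) (m2-n2) (-n1) (-n2) ht0.le ht1 hC (by linarith)
  have h3 := scale_e t (s+e1) e2 s 0 ht0.le ht1 hY hs2
  have h4 := scale_e t (s-e1) e2 s 0 ht0.le ht1 hX hs2
  have := core_planar (-n1) n2 s (t*m1) (-(t*m2)) (t*e1) (t*e2) (by linarith) (by linarith)
    (by linarith) (by linarith) (by linarith) (by linarith) hs (by nlinarith only [hbc, ht0])
  linarith

/-- dot product of triples -/
def dt (v w : Fin 3 → ℝ) : ℝ := v 0*w 0+v 1*w 1+v 2*w 2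
/-- determinant of triples -/
def det3 (u v w : Fin 3 → ℝ) : ℝ :=
  u 0*(v 1*w 2-v 2*w 1) - u 1*(v 0*w 2-v 2*w 0) + u 2*(v 0*w 1-v 1*w 0)

lemma dt_self_nonneg (v : Fin 3 → ℝ) : 0 ≤ dt v v := by
  simp only [dt]
  linarith [mul_self_nonneg (v 0), mul_self_nonneg (v 1), mul_self_nonneg (v 2)]

lemma dt_self_pos {u : Fin 3 → ℝ} (hu : u ≠ 0) : 0 < dt u u := by
  by_contra h
  apply hu
  simp only [dt] at h
  ext i
  fin_cases i <;> simp <;> nlinarith [mul_self_nonneg (u 0), mul_self_nonneg (u 1), mul_self_nonneg (u 2)]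

lemma exists_unit {v : Fin 3 → ℝ} (hv : v ≠ 0) : ∃ (k : ℝ) (f : Fin 3 → ℝ), 0 < k ∧ dt f f = 1 ∧ v = k • f := by
  obtain ⟨k, hk0, hk⟩ := exists_sqrt_aux (dt_self_pos hv).le
  have hkp : 0 < k := lt_of_le_of_ne hk0 (by
    rintro rfl
    have := dt_self_pos hv
    norm_num at hk
    linarith)
  refine ⟨k, k⁻¹ • v, hkp, ?_, ?_⟩
  · have : dt (k⁻¹ • v) (k⁻¹ • v) = k⁻¹^2 * dt v v := by simp [dt]; ring
    rw [this, ← hk]; field_simp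
  · rw [smul_smul, mul_inv_cancel₀ hkp.ne', one_smul]

lemma exists_perp (u : Fin 3 → ℝ) : ∃ f : Fin 3 → ℝ, dt f f = 1 ∧ dt f u = 0 := by
  by_cases h : (![-(u 1), u 0, 0] : Fin 3 → ℝ) = 0
  · have h0 : u 0 = 0 := by simpa using congrFun h 1
    exact ⟨![1,0,0], by simp [dt], by simp [dt, h0]⟩
  · obtain ⟨k, f, hk, hf, hv⟩ := exists_unit h
    refine ⟨f, hf, ?_⟩
    have h1 : k * dt f u = dt (![-(u 1), u 0, 0] : Fin 3 → ℝ) u := by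
      rw [hv]; simp [dt]; ring
    have h2 : dt (![-(u 1), u 0, 0] : Fin 3 → ℝ) u = 0 := by simp [dt]; ring
    rw [h2] at h1
    exact (mul_eq_zero.1 h1).resolve_left hk.ne'

lemma exists_frame0 {u : Fin 3 → ℝ} (hu : u ≠ 0) (s : Fin 3 → ℝ) :
    ∃ (f : Fin 3 → ℝ) (σ l : ℝ), dt f f = 1 ∧ dt f u = 0 ∧ 0 ≤ σ ∧ s = σ • f + l • u := by
  have hup := dt_self_pos hu
  by_cases h : s - (dt s u / dt u u) • u = 0
  · obtain ⟨f, hf, hfu⟩ := exists_perp u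
    exact ⟨f, 0, dt s u / dt u u, hf, hfu, le_rfl, by rw [zero_smul, zero_add]; exact sub_eq_zero.1 h⟩
  · obtain ⟨k, f, hk, hf, hv⟩ := exists_unit h
    refine ⟨f, k, dt s u / dt u u, hf, ?_, hk.le, by rw [← hv]; abel⟩
    have h1 : k * dt f u = dt (s - (dt s u / dt u u) • u) u := by
      rw [hv]; simp [dt]; ring
    have h2 : dt (s - (dt s u / dt u u) • u) u = 0 := by
      have : dt (s - (dt s u / dt u u) • u) u = dt s u - (dt s u / dt u u) * dt u u := by
        simp [dt]; ring
      rw [this, div_mul_cancel₀ _ hup.ne', sub_self]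
    rw [h2] at h1
    exact (mul_eq_zero.1 h1).resolve_left hk.ne'

lemma exists_frame {u : Fin 3 → ℝ} (hu : u ≠ 0) (s : Fin 3 → ℝ) :
    ∃ (f g : Fin 3 → ℝ) (t : ℝ), 0 < t ∧ t^2 = dt u u ∧ 0 ≤ dt f s ∧ dt g s = 0 ∧ dt f u = 0 ∧ dt g u = 0 ∧
      (∀ v, (dt f v)^2+(dt g v)^2 ≤ dt v v) ∧
      (∀ v w, det3 u v w = t*(dt f v * dt g w - dt g v * dt f w)) := by
  obtain ⟨f, σ, l, hf, hfu, hσ, hs⟩ := exists_frame0 hu s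
  obtain ⟨t, t0, ht⟩ := exists_sqrt_aux (dt_self_pos hu).le
  have htp : 0 < t := lt_of_le_of_ne t0 (by
    rintro rfl
    have := dt_self_pos hu
    norm_num at ht
    linarith)
  let g : Fin 3 → ℝ := t⁻¹ • ![u 1*f 2-u 2*f 1, u 2*f 0-u 0*f 2, u 0*f 1-u 1*f 0]
  have hgv : ∀ v, t * dt g v = (u 1*f 2-u 2*f 1)*v 0+(u 2*f 0-u 0*f 2)*v 1+(u 0*f 1-u 1*f 0)*v 2 := by
    intro v
    simp [dt, g]; field_simp
  have hgf : dt g f = 0 := by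
    have : t * dt g f = 0 := by rw [hgv]; ring
    exact (mul_eq_zero.1 this).resolve_left htp.ne'
  have hgu : dt g u = 0 := by
    have : t * dt g u = 0 := by rw [hgv]; ring
    exact (mul_eq_zero.1 this).resolve_left htp.ne'
  have hgg : dt g g = 1 := by
    have h1 : t * (t * dt g g) = t*t := by
      have : t * dt g g = t⁻¹ * (dt u u * dt f f - (dt f u)^2) := by
        rw [hgv]; simp [dt, g]; ring
      rw [this, hf, hfu, ← ht]; field_simp; ring
    have h2 := mul_left_cancel₀ htp.ne' h1
    exact mul_left_cancel₀ htp.ne' (h2.trans (mul_one t).symm)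
  refine ⟨f, g, t, htp, ht, ?_, ?_, hfu, hgu, ?_, ?_⟩
  · have : dt f s = σ * dt f f + l * dt f u := by rw [hs]; simp [dt]; ring
    rw [this, hf, hfu]; linarith
  · have : dt g s = σ * dt g f + l * dt g u := by rw [hs]; simp [dt]; ring
    rw [this, hgf, hgu]; simp
  · intro v
    have h1 : dt (v - dt f v • f - dt g v • g) (v - dt f v • f - dt g v • g)
      = dt v v - 2*(dt f v)^2 - 2*(dt g v)^2 + (dt f v)^2*dt f f + (dt g v)^2*dt g g
        + 2*dt f v*dt g v*dt g f := by
      have key : ∀ a b : ℝ, dt (v - a • f - b • g) (v - a • f - b • g) =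
        dt v v - 2*a*dt f v - 2*b*dt g v + a^2*dt f f + b^2*dt g g + 2*a*b*dt g f := by
        intro a b; simp [dt]; ring
      rw [key]; ring
    have h2 : 0 ≤ dt (v - dt f v • f - dt g v • g) (v - dt f v • f - dt g v • g) := by
      exact dt_self_nonneg _
    rw [h1, hf, hgg, hgf] at h2
    linarith
  · intro v w
    have h1 : t*(dt f v * dt g w - dt g v * dt f w) = dt f v * (t*dt g w) - (t * dt g v)*dt f w := by ring
    rw [h1, hgv, hgv]
    have h2 : dt f v * ((u 1*f 2-u 2*f 1)*w 0+(u 2*f 0-u 0*f 2)*w 1+(u 0*f 1-u 1*f 0)*w 2) -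
      ((u 1*f 2-u 2*f 1)*v 0+(u 2*f 0-u 0*f 2)*v 1+(u 0*f 1-u 1*f 0)*v 2) * dt f w
      = dt f f * det3 u v w - dt f u * det3 f v w := by
      simp [dt, det3]; ring
    rw [h2, hf, hfu]; ring

lemma dt_lin (f v w : Fin 3 → ℝ) (a b : ℝ) : dt f (a • v + b • w) = a * dt f v + b * dt f w := by
  simp [dt]; ring

lemma stacked_bound (p q a b c d : Fin 3 → ℝ)
    (hpq : dt (q-p) (q-p) ≤ 1) (hpb : dt (b-p) (b-p) ≤ 1) (hqb : dt (b-q) (b-q) ≤ 1)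
    (hpc : dt (c-p) (c-p) ≤ 1) (hqc : dt (c-q) (c-q) ≤ 1) (hac : dt (c-a) (c-a) ≤ 1)
    (hbd : dt (d-b) (d-b) ≤ 1) (had : dt (d-a) (d-a) ≤ 1) (hbc : dt (b-c) (b-c) ≤ 1)
    (hdet : 0 ≤ det3 (q-p) (b-p) (c-p)) :
    det3 (q-p) (a-p) (b-p) + det3 (q-p) (b-p) (c-p) + det3 (q-p) (c-p) (d-p) ≤ 11754/10000 := by
  by_cases hu : q - p = 0
  · rw [hu]; simp [det3]; norm_num
  obtain ⟨f, g, t, ht0, ht, hfs, hgs, hfq, hgq, hN, hD⟩ :=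
    exists_frame hu ((1/2:ℝ) • ((c-a)+(d-b)))
  have ht1 : t ≤ 1 := by nlinarith only [ht, hpq, ht0]
  -- planar coordinates
  have hB : dt (b-(1/2:ℝ)•(p+q)) (b-(1/2:ℝ)•(p+q)) ≤ 1-t^2/4 := by
    have : dt (b-(1/2:ℝ)•(p+q)) (b-(1/2:ℝ)•(p+q)) =
      (dt (b-p) (b-p) + dt (b-q) (b-q))/2 - dt (q-p) (q-p)/4 := by simp [dt]; ring
    rw [this, ← ht]; linarith
  have hC : dt (c-(1/2:ℝ)•(p+q)) (c-(1/2:ℝ)•(p+q)) ≤ 1-t^2/4 := by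
    have : dt (c-(1/2:ℝ)•(p+q)) (c-(1/2:ℝ)•(p+q)) =
      (dt (c-p) (c-p) + dt (c-q) (c-q))/2 - dt (q-p) (q-p)/4 := by simp [dt]; ring
    rw [this, ← ht]; linarith
  have lin : ∀ f : Fin 3 → ℝ, ∀ v w, dt f (v - w) = dt f v - dt f w := by
    intro f v w; simp [dt]; ring
  have lin2 : ∀ f : Fin 3 → ℝ, ∀ v w, dt f (v + w) = dt f v + dt f w := by
    intro f v w; simp [dt]; ring
  have lin3 : ∀ f : Fin 3 → ℝ, ∀ (k : ℝ) v, dt f (k • v) = k * dt f v := by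
    intro f k v; simp [dt]; ring
  have e1 := hN (b-(1/2:ℝ)•(p+q))
  have e2 := hN (c-(1/2:ℝ)•(p+q))
  have e3 := hN (c-a)
  have e4 := hN (d-b)
  have e5 := hN (b-c)
  have e6 := hN (d-a)
  rw [hD] at hdet
  rw [hD, hD, hD]
  simp only [lin, lin2, lin3] at *
  generalize dt f a = a1 at *
  generalize dt f b = b1 at *
  generalize dt f c = c1 at *
  generalize dt f d = d1 at *
  generalize dt f p = p1 at *
  generalize dt f q = q1 at *
  generalize dt g a = a2 at *
  generalize dt g b = b2 at *
  generalize dt g c = c2 at *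
  generalize dt g d = d2 at *
  generalize dt g p = p2 at *
  generalize dt g q = q2 at *
  obtain rfl : q1 = p1 := by linarith
  obtain rfl : q2 = p2 := by linarith
  have k1 : d2 = a2 + b2 - c2 := by linarith
  subst k1
  have hbc' : 0 ≤ (b1-q1)*(c2-q2)-(b2-q2)*(c1-q1) := by
    by_contra h
    push Not at h
    have := mul_neg_of_pos_of_neg ht0 h
    linarith
  have := planar2 t ((b1+c1)/2-q1) ((b2+c2)/2-q2) ((b1-c1)/2) ((b2-c2)/2)
    (((d1-b1)-(c1-a1))/2) (((a2+b2-c2-b2)-(c2-a2))/2) (((c1-a1)+(d1-b1))/2) ht0 ht1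
    (by linarith) (by linarith) (by linarith) (by linarith) (by linarith) (by linarith)
    (by linarith) (by linarith)
  linarith


/-- sign of a boolean -/
def sg (b : Bool) : ℝ := if b then 1 else -1

/-- normal form of a planar vector configuration -/
def NF (α β : Fin 6 → ℝ) (ε : Fin 6 → Bool) : Prop :=
  ∀ i j, i < j → 0 < sg (ε i) * sg (ε j) * (α i * β j - α j * β i)

/-- cyclic shift of sign vectors -/
def shiftB (ε : Fin 6 → Bool) : Fin 6 → Bool := fun i => if i = 5 then !(ε 0) else ε (i + 1)

lemma NF_shift {α β : Fin 6 → ℝ} {ε : Fin 6 → Bool} (h : NF α β ε) :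
    NF (fun i => α (i + 1)) (fun i => β (i + 1)) (shiftB ε) := by
  intro i j hij
  have hi : i ≠ 5 := by omega
  by_cases hj : j = 5
  · subst hj
    have h1 : (5 : Fin 6) + 1 = 0 := by decide
    have h2 : (0 : Fin 6) < i + 1 := by revert hij; revert i; decide
    have h3 := h 0 (i+1) h2
    simp only [shiftB, hi, if_true, if_false, h1]
    have h4 : sg (!(ε 0)) = - sg (ε 0) := by cases ε 0 <;> simp [sg]
    rw [h4]
    linarith
  · simp only [shiftB, hi, hj, if_false]
    exact h _ _ (by revert hij hj; revert i j; decide)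

def t1 : Fin 6 → Bool := ![true, false, true, false, true, true]
def t2 : Fin 6 → Bool := ![true, true, false, false, true, true]
def t3 : Fin 6 → Bool := ![true, true, false, true, true, true]
def t4 : Fin 6 → Bool := ![true, false, true, true, true, true]
def t5 : Fin 6 → Bool := ![true, false, false, true, true, true]
def t0 : Fin 6 → Bool := fun _ => true

set_option maxRecDepth 10000 in
lemma shift_cases : ∀ ε : Fin 6 → Bool, ∃ n : Fin 12,
    (∀ i, shiftB^[n] ε i = t0 i) ∨ (∀ i, shiftB^[n] ε i = t1 i) ∨ (∀ i, shiftB^[n] ε i = t2 i) ∨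
    (∀ i, shiftB^[n] ε i = t3 i) ∨ (∀ i, shiftB^[n] ε i = t4 i) ∨ (∀ i, shiftB^[n] ε i = t5 i) := by
  decide +kernel

lemma NF_iter {α β : Fin 6 → ℝ} {ε : Fin 6 → Bool} (h : NF α β ε) (n : ℕ) :
    ∃ σ : Equiv.Perm (Fin 6), NF (α ∘ σ) (β ∘ σ) (shiftB^[n] ε) := by
  induction n with
  | zero => exact ⟨1, h⟩
  | succ n ih =>
    obtain ⟨σ, hσ⟩ := ih
    rw [Function.iterate_succ_apply']
    exact ⟨(Equiv.addRight (1 : Fin 6)).trans σ, NF_shift hσ⟩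

lemma NF_t0 {α β : Fin 6 → ℝ} (hα : ∑ i, α i = 0) (hβ : ∑ i, β i = 0) : ¬ NF α β t0 := by
  intro h
  have a1 := h 0 1 (by decide)
  have a2 := h 0 2 (by decide)
  have a3 := h 0 3 (by decide)
  have a4 := h 0 4 (by decide)
  have a5 := h 0 5 (by decide)
  simp only [t0, sg, if_true] at a1 a2 a3 a4 a5
  simp only [Fin.sum_univ_six] at hα hβ
  have e1 : α 0 * (β 0+β 1+β 2+β 3+β 4+β 5) = 0 := by rw [hβ]; ring
  have e2 : β 0 * (α 0+α 1+α 2+α 3+α 4+α 5) = 0 := by rw [hα]; ring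
  linarith

lemma exists_NF {α β : Fin 6 → ℝ} (hD : ∀ i j, i ≠ j → α i * β j - α j * β i ≠ 0) :
    ∃ (σ : Equiv.Perm (Fin 6)) (ε : Fin 6 → Bool), NF (α ∘ σ) (β ∘ σ) ε := by
  -- generic rotation
  obtain ⟨t, ht⟩ : ∃ t : ℝ, ∀ i, α i + t * β i ≠ 0 := by
    have hfin : (Set.range fun i => - α i / β i).Finite := Set.finite_range _
    obtain ⟨t, ht⟩ := (hfin.union (Set.finite_singleton 0)).exists_notMem
    refine ⟨t, fun i hi => ht ?_⟩
    by_cases hb : β i = 0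
    · exfalso
      rw [hb] at hi
      have ha : α i = 0 := by linarith
      have : ∃ j, i ≠ j := ⟨i+1, (by decide : ∀ i : Fin 6, i ≠ i+1) i⟩
      obtain ⟨j, hj⟩ := this
      exact hD i j hj (by rw [ha, hb]; ring)
    · left
      exact ⟨i, by field_simp; linarith⟩
  set a : Fin 6 → ℝ := fun i => α i + t * β i with ha
  have hDa : ∀ i j, α i * β j - α j * β i = a i * a j * (β j / a j - β i / a i) := by
    intro i j
    have h1 := ht i
    have h2 := ht j
    change a i ≠ 0 at h1
    change a j ≠ 0 at h2
    have : a i * a j * (β j / a j - β i / a i) = a i * β j - a j * β i := by field_simp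
    rw [this]; simp only [ha]; ring
  let r : Fin 6 → ℝ := fun i => β i / a i
  have hr : Function.Injective r := by
    intro i j hij
    by_contra hne
    apply hD i j hne
    rw [hDa]
    have : β i / a i = β j / a j := hij
    rw [this]; ring
  let σ := Tuple.sort r
  have hmono : Monotone (r ∘ σ) := Tuple.monotone_sort r
  have hsm : StrictMono (r ∘ σ) := hmono.strictMono_of_injective (hr.comp σ.injective)
  refine ⟨σ, fun i => decide (0 < a (σ i)), fun i j hij => ?_⟩
  have h1 : 0 < β (σ j) / a (σ j) - β (σ i) / a (σ i) := sub_pos.2 (hsm hij)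
  have hpos : ∀ i, 0 < sg (decide (0 < a i)) * a i := by
    intro i
    by_cases h : 0 < a i
    · simp [sg, h]
    · have h2 : a i ≠ 0 := ht i
      have h3 : a i < 0 := lt_of_le_of_ne (not_lt.1 h) h2
      simp [sg, h, h3]
  simp only [Function.comp]
  rw [hDa]
  have := mul_pos (mul_pos (hpos (σ i)) (hpos (σ j))) h1
  linarith

lemma exists_type {α β : Fin 6 → ℝ} (hD : ∀ i j, i ≠ j → α i * β j - α j * β i ≠ 0)
    (hα : ∑ i, α i = 0) (hβ : ∑ i, β i = 0) :
    ∃ σ : Equiv.Perm (Fin 6), NF (α ∘ σ) (β ∘ σ) t1 ∨ NF (α ∘ σ) (β ∘ σ) t2 ∨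
      NF (α ∘ σ) (β ∘ σ) t3 ∨ NF (α ∘ σ) (β ∘ σ) t4 ∨ NF (α ∘ σ) (β ∘ σ) t5 := by
  obtain ⟨σ, ε, h⟩ := exists_NF hD
  obtain ⟨n, hn⟩ := shift_cases ε
  obtain ⟨τ, hτ⟩ := NF_iter h n
  refine ⟨τ.trans σ, ?_⟩
  change NF (α ∘ (τ.trans σ)) (β ∘ (τ.trans σ)) _ at hτ
  simp only [← funext_iff] at hn
  rcases hn with h | h | h | h | h | h <;> rw [h] at hτ
  · exfalso
    refine NF_t0 ?_ ?_ hτ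
    · rw [← hα]; exact Equiv.sum_comp (τ.trans σ) α
    · rw [← hβ]; exact Equiv.sum_comp (τ.trans σ) β
  all_goals tauto

/-- covering property of a configuration for a sign type -/
def Cover (T : Fin 6 → Bool) (p : Fin 6 → Fin 3 → ℝ) : Prop :=
  ∀ c ∈ stdSimplex ℝ (Fin 6), ∃ i j, (i < j ∧ T i = true ∧ T j = false) ∧
    ∃ c' ∈ stdSimplex ℝ (Fin 6), c' i = 0 ∧ c' j = 0 ∧ ∑ k, c' k • p k = ∑ k, c k • p k

lemma cover_of_NF {α β : Fin 6 → ℝ} {T : Fin 6 → Bool} {p : Fin 6 → Fin 3 → ℝ} (hT : T 5 = true)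
    (h : NF α β T) (hα : ∑ i, α i = 0) (hβ : ∑ i, β i = 0) (hpα : ∑ i, α i • p i = 0)
    (hpβ : ∑ i, β i • p i = 0) : Cover T p := by
  intro c hc
  let K : Set (Fin 6 → ℝ) := stdSimplex ℝ (Fin 6) ∩ {c' | ∑ k, c' k • p k = ∑ k, c k • p k}
  have hK : IsCompact K := (isCompact_stdSimplex ℝ (Fin 6)).inter_right
    (isClosed_eq (by fun_prop) continuous_const)
  obtain ⟨d, hdK, hmax⟩ := hK.exists_isMaxOn (f := fun c' => c' 5) ⟨c, hc, rfl⟩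
    (by fun_prop)
  obtain ⟨⟨hd0, hd1⟩, hdp⟩ := hdK
  by_contra hcon
  push Not at hcon
  have hZ : ∀ i j, i < j → T i = true → T j = false → d i = 0 → d j = 0 → False := by
    intro i j hij hi hj h1 h2
    exact hcon i j ⟨hij, hi, hj⟩ d ⟨hd0, hd1⟩ h1 h2 hdp
  -- an improving direction
  obtain ⟨γ, hγ0, hγp, hγ5, hγZ⟩ : ∃ γ : Fin 6 → ℝ, ∑ i, γ i = 0 ∧ ∑ i, γ i • p i = 0 ∧
      0 < γ 5 ∧ ∀ i, d i = 0 → 0 ≤ γ i := by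
    obtain ⟨k, hk5, hklt, hkgt⟩ : ∃ k : Fin 6, k < 5 ∧ (∀ i < k, d i = 0 → T i = false) ∧
        (∀ i, k < i → d i = 0 → T i = true) := by
      by_cases hne : ((Finset.univ : Finset (Fin 6)).filter (fun i => d i = 0 ∧ T i = false)).Nonempty
      · obtain ⟨k, hk, hkm⟩ := Finset.exists_max_image _ id hne
        simp only [Finset.mem_filter, Finset.mem_univ, true_and, id] at hk hkm
        refine ⟨k, ?_, ?_, ?_⟩
        · by_contra h5
          have : k = 5 := by omega
          rw [this, hT] at hk
          simp at hk
        · intro i hik hi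
          by_contra hTi
          exact hZ i k hik (by simpa using hTi) hk.2 hi hk.1
        · intro i hik hi
          by_contra hTi
          have := hkm i ⟨hi, by simpa using hTi⟩
          omega
      · refine ⟨0, by decide, fun i hi => absurd hi (by omega), fun i _ hi => ?_⟩
        by_contra hTi
        exact hne ⟨i, by simp [hi]; simpa using hTi⟩
    refine ⟨fun i => sg (T k) * (α k * β i - α i * β k), ?_, ?_, ?_, ?_⟩
    · rw [← Finset.mul_sum, Finset.sum_sub_distrib, ← Finset.mul_sum, ← Finset.sum_mul, hα, hβ]
      ring
    · have : ∀ i, (sg (T k) * (α k * β i - α i * β k)) • p i =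
          (sg (T k) * α k) • (β i • p i) - (sg (T k) * β k) • (α i • p i) := by
        intro i; module
      simp only [this]
      rw [Finset.sum_sub_distrib, ← Finset.smul_sum, ← Finset.smul_sum, hpα, hpβ]
      simp
    · have := h k 5 hk5
      rw [hT] at this
      simpa [sg] using this
    · intro i hi
      rcases lt_trichotomy i k with hik | hik | hik
      · have h1 := h i k hik
        rw [hklt i hik hi] at h1
        simp only [sg, Bool.false_eq_true, if_false] at h1 ⊢
        linarith
      · subst hik; simp
      · have h1 := h k i hik
        rw [hkgt i hik hi] at h1
        simp only [sg, if_true] at h1 ⊢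
        linarith
  -- small step
  obtain ⟨s, hs, hsd⟩ : ∃ s : ℝ, 0 < s ∧ ∀ i, 0 ≤ d i + s * γ i := by
    have : ∀ i, ∀ᶠ s in nhdsWithin (0:ℝ) (Set.Ioi 0), 0 ≤ d i + s * γ i := by
      intro i
      rcases (hd0 i).lt_or_eq with hi | hi
      · have hc : Filter.Tendsto (fun s : ℝ => d i + s * γ i) (nhdsWithin 0 (Set.Ioi 0))
            (nhds (d i + 0 * γ i)) :=
          (Continuous.tendsto (by fun_prop) 0).mono_left nhdsWithin_le_nhds
        have := hc.eventually (lt_mem_nhds (a := 0) (by simpa using hi))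
        exact this.mono fun s hs => hs.le
      · filter_upwards [self_mem_nhdsWithin] with s hs
        have := hγZ i hi.symm
        rw [← hi]
        have := mul_nonneg (le_of_lt hs) this
        linarith
    have h2 := (Filter.eventually_all.2 this).and self_mem_nhdsWithin
    obtain ⟨s, hs1, hs2⟩ := h2.exists
    exact ⟨s, hs2, hs1⟩
  have hmem : (fun i => d i + s * γ i) ∈ K := by
    refine ⟨⟨hsd, ?_⟩, ?_⟩
    · rw [Finset.sum_add_distrib, ← Finset.mul_sum, hγ0, hd1]; ring
    · change ∑ k, (d k + s * γ k) • p k = _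
      have : ∀ i, (d i + s * γ i) • p i = d i • p i + s • (γ i • p i) := by intro i; module
      simp only [this]
      rw [Finset.sum_add_distrib, ← Finset.smul_sum, hγp, smul_zero, add_zero]
      exact hdp
  have := hmax hmem
  change d 5 + s * γ 5 ≤ d 5 at this
  have := mul_pos hs hγ5
  linarith

/-- oriented volume (times six) of a tetrahedron -/
def D4 (a b c d : Fin 3 → ℝ) : ℝ := det3 (b - a) (c - a) (d - a)

/-- general position -/
def Gen (p : Fin 6 → Fin 3 → ℝ) : Prop :=
  ∀ i j k l : Fin 6, i ≠ j → i ≠ k → i ≠ l → j ≠ k → j ≠ l → k ≠ l → D4 (p i) (p j) (p k) (p l) ≠ 0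

lemma sum_D4 {γ : Fin 6 → ℝ} {p : Fin 6 → Fin 3 → ℝ} (h0 : ∑ i, γ i = 0)
    (hp : ∑ i, γ i • p i = 0) (a b c : Fin 3 → ℝ) : ∑ i, γ i * D4 a b c (p i) = 0 := by
  have h1 : ∀ m : Fin 3, ∑ i, γ i * p i m = 0 := by
    intro m
    have := congrFun hp m
    simpa using this
  have h2 : ∀ i, γ i * D4 a b c (p i) = γ i * D4 a b c 0 + 
      ((b-a) 1 * (c-a) 2 - (b-a) 2 * (c-a) 1) * (γ i * p i 0) -
      ((b-a) 0 * (c-a) 2 - (b-a) 2 * (c-a) 0) * (γ i * p i 1) +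
      ((b-a) 0 * (c-a) 1 - (b-a) 1 * (c-a) 0) * (γ i * p i 2) := by
    intro i
    simp only [D4, det3, Pi.sub_apply, Pi.zero_apply]; ring
  simp only [h2]
  rw [Finset.sum_add_distrib, Finset.sum_sub_distrib, Finset.sum_add_distrib, ← Finset.sum_mul,
    ← Finset.mul_sum, ← Finset.mul_sum, ← Finset.mul_sum, h0, h1, h1, h1]
  ring

lemma D4_self3 (a b c : Fin 3 → ℝ) : D4 a b c a = 0 ∧ D4 a b c b = 0 ∧ D4 a b c c = 0 := by
  refine ⟨?_, ?_, ?_⟩ <;> simp only [D4, det3, Pi.sub_apply] <;> ring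

/-- a dependency of the six points -/
def Dep (γ : Fin 6 → ℝ) (p : Fin 6 → Fin 3 → ℝ) : Prop := ∑ i, γ i = 0 ∧ ∑ i, γ i • p i = 0

lemma dep_pair {α β : Fin 6 → ℝ} {p : Fin 6 → Fin 3 → ℝ} (ha : Dep α p) (hb : Dep β p) (x y : ℝ) :
    Dep (fun i => x * α i + y * β i) p := by
  refine ⟨?_, ?_⟩
  · rw [Finset.sum_add_distrib, ← Finset.mul_sum, ← Finset.mul_sum, ha.1, hb.1]; ring
  · have : ∀ i, (x * α i + y * β i) • p i = x • (α i • p i) + y • (β i • p i) := by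
      intro i; module
    simp only [this]
    rw [Finset.sum_add_distrib, ← Finset.smul_sum, ← Finset.smul_sum, ha.2, hb.2]; simp

/-- the six indices are `a b c x y z` -/
def Six (a b c x y z : Fin 6) : Prop := ∀ f : Fin 6 → ℝ, ∑ i, f i = f a + f b + f c + f x + f y + f z

lemma six_of {a b c x y z : Fin 6} (h : (Finset.univ : Finset (Fin 6)) = {a, b, c, x, y, z})
    (h1 : a ∉ ({b, c, x, y, z} : Finset (Fin 6))) (h2 : b ∉ ({c, x, y, z} : Finset (Fin 6)))
    (h3 : c ∉ ({x, y, z} : Finset (Fin 6)))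
    (h4 : x ∉ ({y, z} : Finset (Fin 6))) (h5 : y ∉ ({z} : Finset (Fin 6))) : Six a b c x y z := by
  intro f
  rw [h, Finset.sum_insert h1, Finset.sum_insert h2, Finset.sum_insert h3, Finset.sum_insert h4,
    Finset.sum_insert h5, Finset.sum_singleton]
  ring

lemma dep_D4 {γ : Fin 6 → ℝ} {p : Fin 6 → Fin 3 → ℝ} (h : Dep γ p) {a b c x y z : Fin 6}
    (hs : Six a b c x y z) : γ x * D4 (p a) (p b) (p c) (p x) + γ y * D4 (p a) (p b) (p c) (p y) +
      γ z * D4 (p a) (p b) (p c) (p z) = 0 := by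
  have := sum_D4 h.1 h.2 (p a) (p b) (p c)
  rw [hs] at this
  obtain ⟨e1, e2, e3⟩ := D4_self3 (p a) (p b) (p c)
  rw [e1, e2, e3] at this
  linarith

set_option maxRecDepth 10000 in
set_option synthInstance.maxHeartbeats 400000 in
set_option synthInstance.maxSize 2000 in
lemma complete_triple : ∀ i j k : Fin 6, i ≠ j → k ≠ i → k ≠ j →
      ∃ a b c : Fin 6, a ≠ b ∧ a ≠ c ∧ a ≠ k ∧ b ≠ c ∧ b ≠ k ∧ c ≠ k ∧
      ((Finset.univ : Finset (Fin 6)) = {a, b, c, k, i, j} ∧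
      (a ∉ ({b, c, k, i, j} : Finset (Fin 6))) ∧ (b ∉ ({c, k, i, j} : Finset (Fin 6))) ∧
      (c ∉ ({k, i, j} : Finset (Fin 6))) ∧ (k ∉ ({i, j} : Finset (Fin 6))) ∧
      (i ∉ ({j} : Finset (Fin 6)))) := by
  decide +kernel

/-- a dependency vanishing at two points vanishes -/
lemma dep_zero {γ : Fin 6 → ℝ} {p : Fin 6 → Fin 3 → ℝ} (h : Dep γ p) (hg : Gen p) {i j : Fin 6}
    (hij : i ≠ j) (hi : γ i = 0) (hj : γ j = 0) : ∀ k, γ k = 0 := by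
  intro k
  by_cases hki : k = i
  · rw [hki, hi]
  by_cases hkj : k = j
  · rw [hkj, hj]
  obtain ⟨a, b, c, h1, h2, h3, h4, h5, h6, h7, h8, h9, h10, h11, h12⟩ :=
    complete_triple i j k hij hki hkj
  have := dep_D4 h (six_of h7 h8 h9 h10 h11 h12)
  rw [hi, hj] at this
  have h14 := hg a b c k h1 h2 h3 h4 h5 h6
  have : γ k * D4 (p a) (p b) (p c) (p k) = 0 := by linarith
  exact (mul_eq_zero.1 this).resolve_right h14

/-- Cramer dependency of five points -/
lemma cramer (v1 v2 v3 v4 : Fin 3 → ℝ) : det3 v2 v3 v4 • v1 - det3 v1 v3 v4 • v2 +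
    det3 v1 v2 v4 • v3 - det3 v1 v2 v3 • v4 = 0 := by
  ext m
  fin_cases m <;> simp [det3] <;> ring

lemma exists_dep {p : Fin 6 → Fin 3 → ℝ} (hg : Gen p) {o a b c d z : Fin 6} (hs : Six o a b c d z)
    (hne : o ≠ b ∧ o ≠ c ∧ o ≠ d ∧ b ≠ c ∧ b ≠ d ∧ c ≠ d)
    (hnd : a ≠ b ∧ a ≠ c ∧ a ≠ d ∧ a ≠ z ∧ a ≠ o ∧ b ≠ z ∧ c ≠ z ∧ d ≠ z ∧ o ≠ z) :
    ∃ γ, Dep γ p ∧ γ z = 0 ∧ γ a ≠ 0 := by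
  let A := det3 (p b - p o) (p c - p o) (p d - p o)
  let B := det3 (p a - p o) (p c - p o) (p d - p o)
  let C := det3 (p a - p o) (p b - p o) (p d - p o)
  let D := det3 (p a - p o) (p b - p o) (p c - p o)
  obtain ⟨n1, n2, n3, n4, n5, n6⟩ := hne
  obtain ⟨m1, m2, m3, m4, m5, m6, m7, m8, m9⟩ := hnd
  let γ : Fin 6 → ℝ := fun i => if i = a then A else if i = b then -B else if i = c then C else
    if i = d then -D else if i = o then -(A-B+C-D) else 0
  have ga : γ a = A := by simp [γ]
  have gb : γ b = -B := by simp [γ, m1.symm]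
  have gc : γ c = C := by simp [γ, m2.symm, n4.symm]
  have gd : γ d = -D := by simp [γ, m3.symm, n5.symm, n6.symm]
  have go : γ o = -(A-B+C-D) := by simp [γ, m5.symm, n1, n2, n3]
  have gz : γ z = 0 := by simp [γ, m4.symm, m6.symm, m7.symm, m8.symm, m9.symm]
  refine ⟨γ, ⟨?_, ?_⟩, gz, ?_⟩
  · rw [hs, ga, gb, gc, gd, go, gz]; ring
  · ext m
    have h1 := congrFun (cramer (p a - p o) (p b - p o) (p c - p o) (p d - p o)) m
    change (A • (p a - p o) - B • (p b - p o) + C • (p c - p o) - D • (p d - p o)) m = 0 at h1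
    simp only [Finset.sum_apply, Pi.smul_apply, smul_eq_mul, Pi.zero_apply]
    rw [hs, ga, gb, gc, gd, go, gz]
    simp only [Pi.add_apply, Pi.sub_apply, Pi.smul_apply, smul_eq_mul] at h1
    linarith
  · rw [ga]
    exact hg o b c d n1 n2 n3 n4 n5 n6

lemma exists_pair {p : Fin 6 → Fin 3 → ℝ} (hg : Gen p) : ∃ α β, Dep α p ∧ Dep β p ∧
    ∀ i j, i ≠ j → α i * β j - α j * β i ≠ 0 := by
  obtain ⟨α, hα, hα5, hα0⟩ := exists_dep (o := 1) (a := 0) (b := 2) (c := 3) (d := 4) (z := 5) hg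
    (six_of (by decide) (by decide) (by decide) (by decide) (by decide) (by decide))
    (by decide) (by decide)
  obtain ⟨β, hβ, hβ0, hβ5⟩ := exists_dep (o := 1) (a := 5) (b := 2) (c := 3) (d := 4) (z := 0) hg
    (six_of (by decide) (by decide) (by decide) (by decide) (by decide) (by decide))
    (by decide) (by decide)
  refine ⟨α, β, hα, hβ, fun i j hij h => ?_⟩
  have hz : ∀ k, β j * α k + (-α j) * β k = 0 :=
    dep_zero (dep_pair hα hβ (β j) (-α j)) hg hij (by linarith) (by ring)
  have h1 : β j = 0 := by
    have := hz 0
    rw [hβ0] at this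
    have : β j * α 0 = 0 := by linarith
    exact (mul_eq_zero.1 this).resolve_right hα0
  have h2 : α j = 0 := by
    have := hz 5
    rw [hα5] at this
    have : α j * β 5 = 0 := by linarith
    exact (mul_eq_zero.1 this).resolve_right hβ5
  have hj5 : j ≠ 5 := by rintro rfl; exact hβ5 h1
  exact hα0 (dep_zero hα hg hj5 h2 hα5 0)

/-- sign relation for two apexes over a common triangle -/
lemma sign_rel {α β : Fin 6 → ℝ} {p : Fin 6 → Fin 3 → ℝ} (ha : Dep α p) (hb : Dep β p)
    {a b c x y z : Fin 6} (hs : Six a b c x y z) :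
    (α x * β z - α z * β x) * D4 (p a) (p b) (p c) (p x) +
    (α y * β z - α z * β y) * D4 (p a) (p b) (p c) (p y) = 0 := by
  have := dep_D4 (dep_pair ha hb (β z) (-α z)) hs
  linarith

lemma opp_of_rel {u v x y : ℝ} (h : u * x + v * y = 0) (huv : 0 < u * v) (hx : x ≠ 0) : x * y < 0 := by
  have h1 : (u*v)*(x*y) = -(u*x)^2 := by linear_combination (u*x)*h
  have hu : u ≠ 0 := by rintro rfl; simp at huv
  have : 0 < (u*x)^2 := by positivity
  by_contra hc
  push Not at hc
  have := mul_nonneg huv.le hc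
  linarith

/-- opposite sides -/
lemma opp {α β : Fin 6 → ℝ} {p : Fin 6 → Fin 3 → ℝ} (ha : Dep α p) (hb : Dep β p) (hg : Gen p)
    {a b c x y z : Fin 6} (hs : Six a b c x y z)
    (hd : a ≠ b ∧ a ≠ c ∧ a ≠ x ∧ b ≠ c ∧ b ≠ x ∧ c ≠ x)
    (huv : 0 < (α x * β z - α z * β x) * (α y * β z - α z * β y)) :
    D4 (p a) (p b) (p c) (p x) * D4 (p a) (p b) (p c) (p y) < 0 :=
  opp_of_rel (sign_rel ha hb hs) huv
    (hg _ _ _ _ hd.1 hd.2.1 hd.2.2.1 hd.2.2.2.1 hd.2.2.2.2.1 hd.2.2.2.2.2)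

/-- weak sign conditions -/
def Sgn1 (p : Fin 6 → Fin 3 → ℝ) : Prop :=
  (0 ≤ D4 (p 4) (p 5) (p 0) (p 1) ∧ 0 ≤ D4 (p 4) (p 5) (p 1) (p 2) ∧ 0 ≤ D4 (p 4) (p 5) (p 2) (p 3)) ∨
  (D4 (p 4) (p 5) (p 0) (p 1) ≤ 0 ∧ D4 (p 4) (p 5) (p 1) (p 2) ≤ 0 ∧ D4 (p 4) (p 5) (p 2) (p 3) ≤ 0)
def Sgn2 (p : Fin 6 → Fin 3 → ℝ) : Prop :=
  (0 ≤ D4 (p 4) (p 5) (p 0) (p 2) ∧ 0 ≤ D4 (p 4) (p 5) (p 2) (p 1) ∧ 0 ≤ D4 (p 4) (p 5) (p 1) (p 3)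
    ∧ 0 ≤ D4 (p 4) (p 5) (p 3) (p 0)) ∨
  (D4 (p 4) (p 5) (p 0) (p 2) ≤ 0 ∧ D4 (p 4) (p 5) (p 2) (p 1) ≤ 0 ∧ D4 (p 4) (p 5) (p 1) (p 3) ≤ 0
    ∧ D4 (p 4) (p 5) (p 3) (p 0) ≤ 0)
def Sgn3 (p : Fin 6 → Fin 3 → ℝ) : Prop :=
  D4 (p 3) (p 4) (p 5) (p 0) * D4 (p 3) (p 4) (p 5) (p 1) ≤ 0
def Sgn5 (p : Fin 6 → Fin 3 → ℝ) : Prop :=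
  D4 (p 3) (p 4) (p 5) (p 1) * D4 (p 3) (p 4) (p 5) (p 2) ≤ 0

lemma D4_swap (a b c d : Fin 3 → ℝ) : D4 a b c d = - D4 a b d c := by
  simp only [D4, det3, Pi.sub_apply]; ring

lemma pos_of_mul_pos_of_pos {y z : ℝ} (h : 0 < y * z) (hy : 0 < y) : 0 < z :=
  (mul_pos_iff_of_pos_left hy).1 h

lemma same_chain2 {x y z : ℝ} (h1 : 0 < x * y) (h2 : 0 < y * z) :
    (0 ≤ x ∧ 0 ≤ y ∧ 0 ≤ z) ∨ (x ≤ 0 ∧ y ≤ 0 ∧ z ≤ 0) := by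
  rcases pos_and_pos_or_neg_and_neg_of_mul_pos h1 with ⟨a, b⟩ | ⟨a, b⟩
  · left; exact ⟨a.le, b.le, (pos_of_mul_pos_of_pos h2 b).le⟩
  · right
    refine ⟨a.le, b.le, ?_⟩
    by_contra hc
    push Not at hc
    nlinarith

lemma sgn1_of {α β : Fin 6 → ℝ} {p : Fin 6 → Fin 3 → ℝ} (ha : Dep α p) (hb : Dep β p) (hg : Gen p)
    (h : NF α β t1) : Sgn1 p := by
  have h1 := opp (a := 4) (b := 5) (c := 1) (x := 0) (y := 2) (z := 3) ha hb hg
    (six_of (by decide) (by decide) (by decide) (by decide) (by decide) (by decide)) (by decide)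
    (by
      have e1 := h 0 3 (by decide)
      have e2 := h 2 3 (by decide)
      simp [t1, sg] at e1 e2
      exact mul_pos_of_neg_of_neg (by linarith) (by linarith))
  have h2 := opp (a := 4) (b := 5) (c := 2) (x := 1) (y := 3) (z := 0) ha hb hg
    (six_of (by decide) (by decide) (by decide) (by decide) (by decide) (by decide)) (by decide)
    (by
      have e1 := h 0 1 (by decide)
      have e2 := h 0 3 (by decide)
      simp [t1, sg] at e1 e2
      exact mul_pos (by linarith) (by linarith))
  apply same_chain2
  · rw [D4_swap _ _ (p 0)]; linarith
  · rw [D4_swap _ _ (p 1)]; linarith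

lemma sgn2_of {α β : Fin 6 → ℝ} {p : Fin 6 → Fin 3 → ℝ} (ha : Dep α p) (hb : Dep β p) (hg : Gen p)
    (h : NF α β t2) : Sgn2 p := by
  have h1 := opp (a := 4) (b := 5) (c := 2) (x := 0) (y := 1) (z := 3) ha hb hg
    (six_of (by decide) (by decide) (by decide) (by decide) (by decide) (by decide)) (by decide)
    (by
      have e1 := h 0 3 (by decide)
      have e2 := h 1 3 (by decide)
      simp [t2, sg] at e1 e2
      exact mul_pos_of_neg_of_neg (by linarith) (by linarith))
  have h2 := opp (a := 4) (b := 5) (c := 1) (x := 2) (y := 3) (z := 0) ha hb hg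
    (six_of (by decide) (by decide) (by decide) (by decide) (by decide) (by decide)) (by decide)
    (by
      have e1 := h 0 2 (by decide)
      have e2 := h 0 3 (by decide)
      simp [t2, sg] at e1 e2
      exact mul_pos (by linarith) (by linarith))
  have h3 := opp (a := 4) (b := 5) (c := 3) (x := 1) (y := 0) (z := 2) ha hb hg
    (six_of (by decide) (by decide) (by decide) (by decide) (by decide) (by decide)) (by decide)
    (by
      have e1 := h 0 2 (by decide)
      have e2 := h 1 2 (by decide)
      simp [t2, sg] at e1 e2
      exact mul_pos_of_neg_of_neg (by linarith) (by linarith))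
  have f1 : 0 < D4 (p 4) (p 5) (p 0) (p 2) * D4 (p 4) (p 5) (p 2) (p 1) := by
    rw [D4_swap _ _ (p 0)]; linarith
  have f2 : 0 < D4 (p 4) (p 5) (p 2) (p 1) * D4 (p 4) (p 5) (p 1) (p 3) := by
    rw [D4_swap _ _ (p 2)]; linarith
  have f3 : 0 < D4 (p 4) (p 5) (p 1) (p 3) * D4 (p 4) (p 5) (p 3) (p 0) := by
    rw [D4_swap _ _ (p 1)]; linarith
  rcases same_chain2 f1 f2 with ⟨a, b, c⟩ | ⟨a, b, c⟩
  · left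
    refine ⟨a, b, c, ?_⟩
    by_contra hc
    push Not at hc
    nlinarith
  · right
    refine ⟨a, b, c, ?_⟩
    by_contra hc
    push Not at hc
    nlinarith

lemma sgn3_of {α β : Fin 6 → ℝ} {p : Fin 6 → Fin 3 → ℝ} (ha : Dep α p) (hb : Dep β p) (hg : Gen p)
    (h : NF α β t3) : Sgn3 p := by
  have h1 := opp (a := 3) (b := 4) (c := 5) (x := 0) (y := 1) (z := 2) ha hb hg
    (six_of (by decide) (by decide) (by decide) (by decide) (by decide) (by decide)) (by decide)
    (by
      have e1 := h 0 2 (by decide)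
      have e2 := h 1 2 (by decide)
      simp [t3, sg] at e1 e2
      exact mul_pos_of_neg_of_neg (by linarith) (by linarith))
  exact h1.le

lemma sgn5_of {α β : Fin 6 → ℝ} {p : Fin 6 → Fin 3 → ℝ} (ha : Dep α p) (hb : Dep β p) (hg : Gen p)
    (h : NF α β t5) : Sgn5 p := by
  have h1 := opp (a := 3) (b := 4) (c := 5) (x := 1) (y := 2) (z := 0) ha hb hg
    (six_of (by decide) (by decide) (by decide) (by decide) (by decide) (by decide)) (by decide)
    (by
      have e1 := h 0 1 (by decide)
      have e2 := h 0 2 (by decide)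
      simp [t5, sg] at e1 e2
      exact mul_pos (by linarith) (by linarith))
  exact h1.le

/-- the classification predicate -/
def Good (p : Fin 6 → Fin 3 → ℝ) : Prop :=
  (Cover t1 p ∧ Sgn1 p) ∨ (Cover t2 p ∧ Sgn2 p) ∨ (Cover t3 p ∧ Sgn3 p) ∨ Cover t4 p ∨
    (Cover t5 p ∧ Sgn5 p)

lemma dep_perm {γ : Fin 6 → ℝ} {p : Fin 6 → Fin 3 → ℝ} (h : Dep γ p) (σ : Equiv.Perm (Fin 6)) :
    Dep (γ ∘ σ) (p ∘ σ) :=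
  ⟨(Equiv.sum_comp σ γ).trans h.1, (Equiv.sum_comp σ (fun i => γ i • p i)).trans h.2⟩

lemma gen_perm {p : Fin 6 → Fin 3 → ℝ} (h : Gen p) (σ : Equiv.Perm (Fin 6)) : Gen (p ∘ σ) := by
  intro i j k l h1 h2 h3 h4 h5 h6
  exact h _ _ _ _ (σ.injective.ne h1) (σ.injective.ne h2) (σ.injective.ne h3) (σ.injective.ne h4)
    (σ.injective.ne h5) (σ.injective.ne h6)

lemma good_of_gen {p : Fin 6 → Fin 3 → ℝ} (hg : Gen p) : ∃ σ : Equiv.Perm (Fin 6), Good (p ∘ σ) := by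
  obtain ⟨α, β, ha, hb, hD⟩ := exists_pair hg
  obtain ⟨σ, h⟩ := exists_type hD ha.1 hb.1
  refine ⟨σ, ?_⟩
  have ha' := dep_perm ha σ
  have hb' := dep_perm hb σ
  have hg' := gen_perm hg σ
  rcases h with h | h | h | h | h
  · exact Or.inl ⟨cover_of_NF rfl h ha'.1 hb'.1 ha'.2 hb'.2, sgn1_of ha' hb' hg' h⟩
  · exact Or.inr (Or.inl ⟨cover_of_NF rfl h ha'.1 hb'.1 ha'.2 hb'.2, sgn2_of ha' hb' hg' h⟩)
  · exact Or.inr (Or.inr (Or.inl ⟨cover_of_NF rfl h ha'.1 hb'.1 ha'.2 hb'.2, sgn3_of ha' hb' hg' h⟩))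
  · exact Or.inr (Or.inr (Or.inr (Or.inl (cover_of_NF rfl h ha'.1 hb'.1 ha'.2 hb'.2))))
  · exact Or.inr (Or.inr (Or.inr (Or.inr ⟨cover_of_NF rfl h ha'.1 hb'.1 ha'.2 hb'.2, sgn5_of ha' hb' hg' h⟩)))

lemma isClosed_or_aux {X : Type*} [TopologicalSpace X] {P Q : X → Prop} (h1 : IsClosed {x | P x})
    (h2 : IsClosed {x | Q x}) : IsClosed {x | P x ∨ Q x} := h1.union h2

lemma isClosed_cover (T : Fin 6 → Bool) : IsClosed {p : Fin 6 → Fin 3 → ℝ | Cover T p} := by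
  have h1 : {p : Fin 6 → Fin 3 → ℝ | Cover T p} = ⋂ c ∈ stdSimplex ℝ (Fin 6),
      ⋃ ij ∈ {ij : Fin 6 × Fin 6 | ij.1 < ij.2 ∧ T ij.1 = true ∧ T ij.2 = false},
      (Prod.snd '' {x : (stdSimplex ℝ (Fin 6)) × (Fin 6 → Fin 3 → ℝ) | 
        (x.1 : Fin 6 → ℝ) ij.1 = 0 ∧ (x.1 : Fin 6 → ℝ) ij.2 = 0 ∧
          ∑ k, (x.1 : Fin 6 → ℝ) k • x.2 k = ∑ k, c k • x.2 k}) := by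
    ext p
    simp only [Set.mem_iInter, Set.mem_iUnion]
    constructor
    · intro h c hc
      obtain ⟨i, j, hij, c', hc', a1, a2, a3⟩ := h c hc
      exact ⟨(i, j), hij, ⟨(⟨c', hc'⟩, p), ⟨a1, a2, a3⟩, rfl⟩⟩
    · intro h c hc
      obtain ⟨⟨i, j⟩, hij, ⟨⟨⟨c', hc'⟩, p'⟩, ⟨a1, a2, a3⟩, rfl⟩⟩ := h c hc
      exact ⟨i, j, hij, c', hc', a1, a2, a3⟩
  rw [h1]
  have : CompactSpace (stdSimplex ℝ (Fin 6)) := isCompact_iff_compactSpace.1 (isCompact_stdSimplex ℝ (Fin 6))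
  have hc : ∀ i, Continuous fun x : (stdSimplex ℝ (Fin 6)) × (Fin 6 → Fin 3 → ℝ) =>
      (x.1 : Fin 6 → ℝ) i :=
    fun i => (continuous_apply i).comp (continuous_subtype_val.comp continuous_fst)
  refine isClosed_biInter fun c _ => Set.Finite.isClosed_biUnion (Set.toFinite _) fun ij _ => ?_
  apply isClosedMap_snd_of_compactSpace
  refine IsClosed.and ?_ (IsClosed.and ?_ ?_)
  · exact isClosed_eq (hc _) continuous_const
  · exact isClosed_eq (hc _) continuous_const
  · exact isClosed_eq (continuous_finsetSum _ fun k _ => (hc k).smul (by fun_prop)) (by fun_prop)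

lemma continuous_D4 (i j k l : Fin 6) :
    Continuous fun p : Fin 6 → Fin 3 → ℝ => D4 (p i) (p j) (p k) (p l) := by
  simp only [D4, det3, Pi.sub_apply]
  fun_prop

lemma isClosed_good : IsClosed {p : Fin 6 → Fin 3 → ℝ | Good p} := by
  have c0 : ∀ i j k l : Fin 6, IsClosed {p : Fin 6 → Fin 3 → ℝ | 0 ≤ D4 (p i) (p j) (p k) (p l)} :=
    fun i j k l => isClosed_le continuous_const (continuous_D4 i j k l)
  have c1 : ∀ i j k l : Fin 6, IsClosed {p : Fin 6 → Fin 3 → ℝ | D4 (p i) (p j) (p k) (p l) ≤ 0} :=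
    fun i j k l => isClosed_le (continuous_D4 i j k l) continuous_const
  refine isClosed_or_aux ((isClosed_cover t1).and ?_) (isClosed_or_aux ((isClosed_cover t2).and ?_)
    (isClosed_or_aux ((isClosed_cover t3).and ?_) (isClosed_or_aux (isClosed_cover t4)
      ((isClosed_cover t5).and ?_))))
  · exact isClosed_or_aux ((c0 _ _ _ _).and ((c0 _ _ _ _).and (c0 _ _ _ _)))
      ((c1 _ _ _ _).and ((c1 _ _ _ _).and (c1 _ _ _ _)))
  · exact isClosed_or_aux ((c0 _ _ _ _).and ((c0 _ _ _ _).and ((c0 _ _ _ _).and (c0 _ _ _ _))))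
      ((c1 _ _ _ _).and ((c1 _ _ _ _).and ((c1 _ _ _ _).and (c1 _ _ _ _))))
  · exact isClosed_le ((continuous_D4 _ _ _ _).mul (continuous_D4 _ _ _ _)) continuous_const
  · exact isClosed_le ((continuous_D4 _ _ _ _).mul (continuous_D4 _ _ _ _)) continuous_const

lemma isClosed_good' : IsClosed {p : Fin 6 → Fin 3 → ℝ | ∃ σ : Equiv.Perm (Fin 6), Good (p ∘ σ)} := by
  have : {p : Fin 6 → Fin 3 → ℝ | ∃ σ : Equiv.Perm (Fin 6), Good (p ∘ σ)} =
    ⋃ σ : Equiv.Perm (Fin 6), {p | Good (p ∘ σ)} := by ext; simp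
  rw [this]
  refine isClosed_iUnion_of_finite fun σ => isClosed_good.preimage ?_
  exact continuous_pi fun i => continuous_apply (σ i)

lemma cubic_near (a b c d : ℝ) (h : a + b + c + d ≠ 0) (U : Set ℝ) (hU : U ∈ nhds (0:ℝ)) :
    ∃ t ∈ U, a + b * t + c * t^2 + d * t^3 ≠ 0 := by
  let P : Polynomial ℝ := Polynomial.C a + Polynomial.C b * Polynomial.X +
    Polynomial.C c * Polynomial.X^2 + Polynomial.C d * Polynomial.X^3
  have hev : ∀ t, P.eval t = a + b * t + c * t^2 + d * t^3 := by intro t; simp [P]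
  have hP : P ≠ 0 := by
    intro h0
    have := hev 1
    rw [h0] at this
    apply h
    simp at this
    linarith
  have hfin : {t | P.IsRoot t}.Finite := Polynomial.finite_setOfPred_isRoot hP
  have hinf : U.Infinite := infinite_of_mem_nhds 0 hU
  obtain ⟨t, ht, hnt⟩ := hinf.exists_notMem_finite hfin
  exact ⟨t, ht, by rw [← hev]; exact hnt⟩

lemma dense_D4 (i j k l : Fin 6) (h1 : i ≠ j) (h2 : i ≠ k) (h3 : i ≠ l) (h4 : j ≠ k) (h5 : j ≠ l)
    (h6 : k ≠ l) : Dense {p : Fin 6 → Fin 3 → ℝ | D4 (p i) (p j) (p k) (p l) ≠ 0} := by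
  intro p
  rw [mem_closure_iff_nhds]
  intro U hU
  let q : Fin 6 → Fin 3 → ℝ := fun m => if m = j then ![1,0,0] else if m = k then ![0,1,0] else
    if m = l then ![0,0,1] else 0
  have qi : q i = 0 := by simp [q, h1, h2, h3]
  have qj : q j = ![1,0,0] := by simp [q]
  have qk : q k = ![0,1,0] := by simp [q, h4.symm]
  have ql : q l = ![0,0,1] := by simp [q, h5.symm, h6.symm]
  let φ : ℝ → Fin 6 → Fin 3 → ℝ := fun t m => (1-t) • p m + t • q m
  have hφc : Continuous φ := by fun_prop
  have hφ0 : φ 0 = p := by ext; simp [φ]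
  have hV : φ ⁻¹' U ∈ nhds (0:ℝ) := hφc.continuousAt.preimage_mem_nhds (by rw [hφ0]; exact hU)
  obtain ⟨a, b, c, d, hpoly⟩ : ∃ a b c d : ℝ, ∀ t, D4 (φ t i) (φ t j) (φ t k) (φ t l) =
      a + b * t + c * t^2 + d * t^3 := by
    have gen : ∀ u v w u' v' w' : Fin 3 → ℝ, ∃ a b c d : ℝ, ∀ t : ℝ,
        det3 ((1-t) • u + t • u') ((1-t) • v + t • v') ((1-t) • w + t • w') =
        a + b * t + c * t^2 + d * t^3 := by
      intro u v w u' v' w'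
      refine ⟨det3 u v w, det3 (u'-u) v w + det3 u (v'-v) w + det3 u v (w'-w),
        det3 u (v'-v) (w'-w) + det3 (u'-u) v (w'-w) + det3 (u'-u) (v'-v) w,
        det3 (u'-u) (v'-v) (w'-w), fun t => ?_⟩
      simp only [det3, Pi.add_apply, Pi.sub_apply, Pi.smul_apply, smul_eq_mul]
      ring
    obtain ⟨a, b, c, d, h⟩ := gen (p j - p i) (p k - p i) (p l - p i) (q j - q i) (q k - q i) (q l - q i)
    refine ⟨a, b, c, d, fun t => ?_⟩
    rw [← h t]
    simp only [D4, φ]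
    congr 1 <;> module
  have hne : a + b + c + d ≠ 0 := by
    have := hpoly 1
    have e : ∀ m, φ 1 m = q m := by intro m; simp [φ]
    rw [e, e, e, e, qi, qj, qk, ql] at this
    simp [D4, det3] at this
    rw [← this]; norm_num
  obtain ⟨t, ht, hnt⟩ := cubic_near a b c d hne _ hV
  exact ⟨φ t, ht, by rw [← hpoly] at hnt; exact hnt⟩

lemma dense_gen : Dense {p : Fin 6 → Fin 3 → ℝ | Gen p} := by
  let I := {x : Fin 6 × Fin 6 × Fin 6 × Fin 6 // x.1 ≠ x.2.1 ∧ x.1 ≠ x.2.2.1 ∧ x.1 ≠ x.2.2.2 ∧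
    x.2.1 ≠ x.2.2.1 ∧ x.2.1 ≠ x.2.2.2 ∧ x.2.2.1 ≠ x.2.2.2}
  have : {p : Fin 6 → Fin 3 → ℝ | Gen p} = ⋂ x : I, {p | D4 (p x.1.1) (p x.1.2.1) (p x.1.2.2.1) (p x.1.2.2.2) ≠ 0} := by
    ext p
    simp only [Set.mem_iInter]
    constructor
    · rintro h ⟨⟨i, j, k, l⟩, a1, a2, a3, a4, a5, a6⟩
      exact h i j k l a1 a2 a3 a4 a5 a6
    · intro h i j k l a1 a2 a3 a4 a5 a6
      exact h ⟨(i, j, k, l), a1, a2, a3, a4, a5, a6⟩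
  rw [this]
  apply dense_iInter_of_isOpen
  · intro x
    exact isOpen_ne_fun (continuous_D4 _ _ _ _) continuous_const
  · rintro ⟨⟨i, j, k, l⟩, a1, a2, a3, a4, a5, a6⟩
    exact dense_D4 i j k l a1 a2 a3 a4 a5 a6

lemma good_all (p : Fin 6 → Fin 3 → ℝ) : ∃ σ : Equiv.Perm (Fin 6), Good (p ∘ σ) := by
  have h : closure {p : Fin 6 → Fin 3 → ℝ | Gen p} ⊆
      {p : Fin 6 → Fin 3 → ℝ | ∃ σ : Equiv.Perm (Fin 6), Good (p ∘ σ)} :=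
    closure_minimal (fun p hp => good_of_gen hp) isClosed_good'
  exact h (dense_gen p)

lemma integral_simplex_aux (n : ℕ) (r : ℝ) :
    ∫ x in (0:ℝ)..r, (r - x)^n / n.factorial = r^(n+1) / (n+1).factorial := by
  rw [intervalIntegral.integral_div]
  rw [intervalIntegral.integral_comp_sub_left (fun x => x^n) r]
  rw [integral_pow, Nat.factorial_succ]
  push_cast
  have : (n.factorial : ℝ) ≠ 0 := by positivity
  field_simp
  simp

lemma vol_simplex_open (n : ℕ) : ∀ r : ℝ, 0 < r →
    volume {x : Fin n → ℝ | (∀ i, 0 < x i) ∧ ∑ i, x i < r} = ENNReal.ofReal (r^n / n.factorial) := by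
  induction n with
  | zero =>
    intro r hr
    have : {x : Fin 0 → ℝ | (∀ i, 0 < x i) ∧ ∑ i, x i < r} = Set.univ := by ext; simp [hr]
    rw [this]; simp [volume_pi]
  | succ n ih =>
    intro r hr
    let e := MeasurableEquiv.piFinSuccAbove (fun _ : Fin (n+1) => ℝ) 0
    have he : MeasurePreserving e := volume_preserving_piFinSuccAbove (fun _ : Fin (n+1) => ℝ) 0
    let S : Set (ℝ × (Fin n → ℝ)) := {y | 0 < y.1 ∧ (∀ i, 0 < y.2 i) ∧ ∑ i, y.2 i < r - y.1}
    have hS : MeasurableSet S := by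
      apply IsOpen.measurableSet
      have h2 : IsOpen {y : ℝ × (Fin n → ℝ) | ∀ i, 0 < y.2 i} := by
        have : {y : ℝ × (Fin n → ℝ) | ∀ i, 0 < y.2 i} = ⋂ i, {y | 0 < y.2 i} := by ext; simp
        rw [this]
        exact isOpen_iInter_of_finite fun i => isOpen_lt (by fun_prop) (by fun_prop)
      exact (isOpen_lt (by fun_prop) (by fun_prop)).and (h2.and (isOpen_lt (by fun_prop) (by fun_prop)))
    have hpre : {x : Fin (n+1) → ℝ | (∀ i, 0 < x i) ∧ ∑ i, x i < r} = e ⁻¹' S := by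
      ext x
      have e1 : (e x).1 = x 0 := rfl
      have e2 : ∀ i, (e x).2 i = x i.succ := fun i => rfl
      change (_ ∧ _) ↔ (_ ∧ _ ∧ _)
      simp only [e1, e2]
      rw [Fin.forall_fin_succ, Fin.sum_univ_succ, and_assoc, lt_sub_iff_add_lt, add_comm (x 0)]
    rw [hpre, he.measure_preimage_equiv, Measure.volume_eq_prod, Measure.prod_apply hS]
    have hsl : ∀ x : ℝ, volume (Prod.mk x ⁻¹' S) =
        (Set.Ioo 0 r).indicator (fun x => ENNReal.ofReal ((r-x)^n / n.factorial)) x := by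
      intro x
      by_cases hx : x ∈ Set.Ioo 0 r
      · rw [Set.indicator_of_mem hx, ← ih (r-x) (by linarith [hx.2])]
        congr 1
        ext y
        change (_ ∧ _ ∧ _) ↔ (_ ∧ _)
        simp [hx.1]
      · rw [Set.indicator_of_notMem hx]
        have : Prod.mk x ⁻¹' S = ∅ := by
          ext y
          simp only [Set.mem_empty_iff_false, iff_false]
          rintro ⟨h1, h2, h3⟩
          apply hx
          refine ⟨h1, ?_⟩
          have : 0 ≤ ∑ i, y i := Finset.sum_nonneg fun i _ => (h2 i).le
          change ∑ i, y i < r - x at h3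
          linarith
        rw [this, measure_empty]
    simp only [hsl]
    rw [lintegral_indicator measurableSet_Ioo, ← ofReal_integral_eq_lintegral_ofReal]
    · rw [← integral_Ioc_eq_integral_Ioo, ← intervalIntegral.integral_of_le hr.le, integral_simplex_aux]
    · apply (Continuous.integrableOn_Icc (by fun_prop)).mono_set Set.Ioo_subset_Icc_self
    · rw [Filter.EventuallyLE, ae_restrict_iff' measurableSet_Ioo]
      refine Filter.Eventually.of_forall fun x hx => ?_
      have : 0 ≤ r - x := by linarith [hx.2]
      simp only [Pi.zero_apply]
      positivity

lemma vol_simplex_closed (n : ℕ) : ∀ r : ℝ, 0 ≤ r →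
    volume {x : Fin n → ℝ | (∀ i, 0 ≤ x i) ∧ ∑ i, x i ≤ r} = ENNReal.ofReal (r^n / n.factorial) := by
  induction n with
  | zero =>
    intro r hr
    have : {x : Fin 0 → ℝ | (∀ i, 0 ≤ x i) ∧ ∑ i, x i ≤ r} = Set.univ := by ext; simp [hr]
    rw [this]; simp [volume_pi]
  | succ n ih =>
    intro r hr
    let e := MeasurableEquiv.piFinSuccAbove (fun _ : Fin (n+1) => ℝ) 0
    have he : MeasurePreserving e := volume_preserving_piFinSuccAbove (fun _ : Fin (n+1) => ℝ) 0
    let S : Set (ℝ × (Fin n → ℝ)) := {y | 0 ≤ y.1 ∧ (∀ i, 0 ≤ y.2 i) ∧ ∑ i, y.2 i ≤ r - y.1}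
    have hS : MeasurableSet S := by
      apply IsClosed.measurableSet
      have h2 : IsClosed {y : ℝ × (Fin n → ℝ) | ∀ i, 0 ≤ y.2 i} := by
        have : {y : ℝ × (Fin n → ℝ) | ∀ i, 0 ≤ y.2 i} = ⋂ i, {y | 0 ≤ y.2 i} := by ext; simp
        rw [this]
        exact isClosed_iInter fun i => isClosed_le (by fun_prop) (by fun_prop)
      exact (isClosed_le (by fun_prop) (by fun_prop)).and (h2.and (isClosed_le (by fun_prop) (by fun_prop)))
    have hpre : {x : Fin (n+1) → ℝ | (∀ i, 0 ≤ x i) ∧ ∑ i, x i ≤ r} = e ⁻¹' S := by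
      ext x
      have e1 : (e x).1 = x 0 := rfl
      have e2 : ∀ i, (e x).2 i = x i.succ := fun i => rfl
      change (_ ∧ _) ↔ (_ ∧ _ ∧ _)
      simp only [e1, e2]
      rw [Fin.forall_fin_succ, Fin.sum_univ_succ, and_assoc, le_sub_iff_add_le, add_comm (x 0)]
    rw [hpre, he.measure_preimage_equiv, Measure.volume_eq_prod, Measure.prod_apply hS]
    have hsl : ∀ x : ℝ, volume (Prod.mk x ⁻¹' S) =
        (Set.Icc 0 r).indicator (fun x => ENNReal.ofReal ((r-x)^n / n.factorial)) x := by
      intro x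
      by_cases hx : x ∈ Set.Icc 0 r
      · rw [Set.indicator_of_mem hx, ← ih (r-x) (by linarith [hx.2])]
        congr 1
        ext y
        change (_ ∧ _ ∧ _) ↔ (_ ∧ _)
        simp [hx.1]
      · rw [Set.indicator_of_notMem hx]
        have : Prod.mk x ⁻¹' S = ∅ := by
          ext y
          simp only [Set.mem_empty_iff_false, iff_false]
          rintro ⟨h1, h2, h3⟩
          apply hx
          refine ⟨h1, ?_⟩
          have : 0 ≤ ∑ i, y i := Finset.sum_nonneg fun i _ => h2 i
          change ∑ i, y i ≤ r - x at h3
          linarith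
        rw [this, measure_empty]
    simp only [hsl]
    rw [lintegral_indicator measurableSet_Icc, ← ofReal_integral_eq_lintegral_ofReal]
    · rw [integral_Icc_eq_integral_Ioc, ← intervalIntegral.integral_of_le hr, integral_simplex_aux]
    · apply (Continuous.integrableOn_Icc (by fun_prop))
    · rw [Filter.EventuallyLE, ae_restrict_iff' measurableSet_Icc]
      refine Filter.Eventually.of_forall fun x hx => ?_
      have : 0 ≤ r - x := by linarith [hx.2]
      simp only [Pi.zero_apply]
      positivity


/-- affine parametrization of a tetrahedron -/
def tmap (a b c d w : Fin 3 → ℝ) : Fin 3 → ℝ := a + (w 0 • (b-a) + w 1 • (c-a) + w 2 • (d-a))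

lemma vol_tmap (a b c d : Fin 3 → ℝ) (s : Set (Fin 3 → ℝ)) :
    volume (tmap a b c d '' s) = ENNReal.ofReal |D4 a b c d| * volume s := by
  let M : Matrix (Fin 3) (Fin 3) ℝ := Matrix.of fun i j => ![b-a, c-a, d-a] j i
  have h1 : tmap a b c d '' s = (fun x => a + x) '' (Matrix.toLin' M '' s) := by
    rw [Set.image_image]
    congr 1
    funext w
    ext m
    simp [tmap, M, Matrix.mulVec, dotProduct, Fin.sum_univ_three]
    ring
  rw [h1, Set.image_add_left, measure_preimage_add, Measure.addHaar_image_linearMap,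
    LinearMap.det_toLin']
  congr 3
  rw [Matrix.det_fin_three]
  simp [M, D4, det3]
  ring

/-- closed standard simplex -/
def simC : Set (Fin 3 → ℝ) := {x | (∀ i, 0 ≤ x i) ∧ ∑ i, x i ≤ 1}
/-- open standard simplex -/
def simO : Set (Fin 3 → ℝ) := {x | (∀ i, 0 < x i) ∧ ∑ i, x i < 1}

lemma vol_simC (a b c d : Fin 3 → ℝ) :
    volume (tmap a b c d '' simC) = ENNReal.ofReal (|D4 a b c d| / 6) := by
  rw [vol_tmap, simC, vol_simplex_closed 3 1 zero_le_one, ← ENNReal.ofReal_mul (abs_nonneg _)]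
  congr 1
  norm_num [Nat.factorial]
  ring

lemma vol_simO (a b c d : Fin 3 → ℝ) :
    volume (tmap a b c d '' simO) = ENNReal.ofReal (|D4 a b c d| / 6) := by
  rw [vol_tmap, simO, vol_simplex_open 3 1 zero_lt_one, ← ENNReal.ofReal_mul (abs_nonneg _)]
  congr 1
  norm_num [Nat.factorial]
  ring

/-- the convex hull of six points -/
def Hull (p : Fin 6 → Fin 3 → ℝ) : Set (Fin 3 → ℝ) :=
  {x | ∃ c ∈ stdSimplex ℝ (Fin 6), x = ∑ k, c k • p k}

lemma hull_perm (p : Fin 6 → Fin 3 → ℝ) (σ : Equiv.Perm (Fin 6)) : Hull p ⊆ Hull (p ∘ σ) := by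
  rintro x ⟨c, ⟨h0, h1⟩, rfl⟩
  exact ⟨c ∘ σ, ⟨fun i => h0 _, (Equiv.sum_comp σ c).trans h1⟩,
    (Equiv.sum_comp σ (fun i => c i • p i)).symm⟩

lemma mem_tet {p : Fin 6 → Fin 3 → ℝ} {c : Fin 6 → ℝ} (hc : c ∈ stdSimplex ℝ (Fin 6))
    {a b e d i j : Fin 6} (hs : Six a b e d i j) (hi : c i = 0) (hj : c j = 0) :
    ∑ k, c k • p k ∈ tmap (p a) (p b) (p e) (p d) '' simC := by
  obtain ⟨h0, h1⟩ := hc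
  rw [hs, hi, hj] at h1
  refine ⟨![c b, c e, c d], ⟨?_, ?_⟩, ?_⟩
  · intro m; fin_cases m <;> simp [h0]
  · rw [Fin.sum_univ_three]
    simp
    linarith [h0 a]
  · ext m
    simp only [Finset.sum_apply, Pi.smul_apply, smul_eq_mul]
    rw [hs (fun k => c k * p k m), hi, hj]
    simp [tmap]
    have : c a = 1 - c b - c e - c d := by linarith
    rw [this]; ring

lemma hadamard {u v w : Fin 3 → ℝ} (hu : dt u u ≤ 1) (hv : dt v v ≤ 1) (hw : dt w w ≤ 1) :
    |det3 u v w| ≤ 1 := by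
  apply abs_le_one_iff_mul_self_le_one.2
  let x : Fin 3 → ℝ := ![v 1*w 2-v 2*w 1, v 2*w 0-v 0*w 2, v 0*w 1-v 1*w 0]
  have e1 : det3 u v w = dt u x := by simp [det3, dt, x]; ring
  have e2 : dt x x = dt v v * dt w w - dt v w ^ 2 := by simp [dt, x]; ring
  have e3 : dt u x * dt u x ≤ dt u u * dt x x := by
    simp only [dt]
    nlinarith only [sq_nonneg (u 0*x 1-u 1*x 0), sq_nonneg (u 0*x 2-u 2*x 0), sq_nonneg (u 1*x 2-u 2*x 1)]
  rw [e1]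
  have n1 := dt_self_nonneg u
  have n2 := dt_self_nonneg x
  have n3 := dt_self_nonneg w
  have e4 : dt v v * dt w w ≤ 1 := mul_le_one₀ hv n3 hw
  have e5 : dt u u * dt x x ≤ 1 := mul_le_one₀ hu n2 (by linarith [sq_nonneg (dt v w)])
  linarith

lemma vol_bound1 {A B : Set (Fin 3 → ℝ)} {x y : ℝ} (hx : 0 ≤ x) (hy : 0 ≤ y)
    (hA : volume A ≤ ENNReal.ofReal x) (hB : volume B ≤ ENNReal.ofReal y) :
    volume (A ∪ B) ≤ ENNReal.ofReal (x + y) := by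
  rw [ENNReal.ofReal_add hx hy]
  exact (measure_union_le A B).trans (add_le_add hA hB)

lemma opp_bound {p : Fin 6 → Fin 3 → ℝ} (hp : ∀ i j, dt (p i - p j) (p i - p j) ≤ 1)
    {a b c x y : Fin 6} (h : D4 (p a) (p b) (p c) (p x) * D4 (p a) (p b) (p c) (p y) ≤ 0) :
    |D4 (p a) (p b) (p c) (p x)| / 6 + |D4 (p a) (p b) (p c) (p y)| / 6 ≤ 1959/10000 := by
  have hh := abs_le.1 (hadamard (hp b a) (hp c a) (hp x y))
  have hid : det3 (p b - p a) (p c - p a) (p x - p y) =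
    D4 (p a) (p b) (p c) (p x) - D4 (p a) (p b) (p c) (p y) := by
    simp only [D4, det3, Pi.sub_apply]; ring
  rw [hid] at hh
  rcases mul_nonpos_iff.1 h with ⟨h1, h2⟩ | ⟨h1, h2⟩
  · rw [abs_of_nonneg h1, abs_of_nonpos h2]; linarith
  · rw [abs_of_nonpos h1, abs_of_nonneg h2]; linarith

lemma vol_hull_good {p : Fin 6 → Fin 3 → ℝ} (hp : ∀ i j, dt (p i - p j) (p i - p j) ≤ 1)
    (hg : Good p) : volume (Hull p) ≤ ENNReal.ofReal (1959/10000) := by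
  rcases hg with ⟨hc, hs⟩ | ⟨hc, hs⟩ | ⟨hc, hs⟩ | hc | ⟨hc, hs⟩
  · have hsub : Hull p ⊆ tmap (p 4) (p 5) (p 0) (p 1) '' simC ∪ (tmap (p 4) (p 5) (p 1) (p 2) '' simC ∪
        tmap (p 4) (p 5) (p 2) (p 3) '' simC) := by
      rintro x ⟨c, hcm, rfl⟩
      obtain ⟨i, j, hij, c', hc', h1, h2, h3⟩ := hc c hcm
      rw [← h3]
      have key : ∀ i j : Fin 6, (i < j ∧ t1 i = true ∧ t1 j = false) →
        (i = 0 ∧ j = 1) ∨ (i = 0 ∧ j = 3) ∨ (i = 2 ∧ j = 3) := by decide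
      rcases key i j hij with ⟨rfl, rfl⟩ | ⟨rfl, rfl⟩ | ⟨rfl, rfl⟩
      · exact Or.inr (Or.inr (mem_tet hc' (six_of (by decide) (by decide) (by decide) (by decide) (by decide) (by decide)) h1 h2))
      · exact Or.inr (Or.inl (mem_tet hc' (six_of (by decide) (by decide) (by decide) (by decide) (by decide) (by decide)) h1 h2))
      · exact Or.inl (mem_tet hc' (six_of (by decide) (by decide) (by decide) (by decide) (by decide) (by decide)) h1 h2)
    refine (measure_mono hsub).trans ((vol_bound1 (by positivity) (by positivity) (vol_simC _ _ _ _).le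
      (vol_bound1 (by positivity) (by positivity) (vol_simC _ _ _ _).le (vol_simC _ _ _ _).le)).trans
      (ENNReal.ofReal_le_ofReal ?_))
    rcases hs with ⟨s1, s2, s3⟩ | ⟨s1, s2, s3⟩
    · rw [abs_of_nonneg s1, abs_of_nonneg s2, abs_of_nonneg s3]
      have := stacked_bound (p 4) (p 5) (p 0) (p 1) (p 2) (p 3) (hp _ _) (hp _ _) (hp _ _) (hp _ _)
        (hp _ _) (hp _ _) (hp _ _) (hp _ _) (hp _ _) s2
      simp only [D4] at *
      linarith
    · rw [abs_of_nonpos s1, abs_of_nonpos s2, abs_of_nonpos s3]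
      have sw : ∀ a b c d : Fin 3 → ℝ, det3 (a - b) (c - b) (d - b) = - D4 a b c d := by
        intro a b c d; simp only [D4, det3, Pi.sub_apply]; ring
      have := stacked_bound (p 5) (p 4) (p 0) (p 1) (p 2) (p 3) (hp _ _) (hp _ _) (hp _ _) (hp _ _)
        (hp _ _) (hp _ _) (hp _ _) (hp _ _) (hp _ _) (by rw [sw]; linarith)
      rw [sw, sw, sw] at this
      linarith
  · have hsub : Hull p ⊆ (tmap (p 4) (p 5) (p 0) (p 2) '' simC ∪ tmap (p 4) (p 5) (p 2) (p 1) '' simC) ∪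
        (tmap (p 4) (p 5) (p 1) (p 3) '' simC ∪ tmap (p 4) (p 5) (p 3) (p 0) '' simC) := by
      rintro x ⟨c, hcm, rfl⟩
      obtain ⟨i, j, hij, c', hc', h1, h2, h3⟩ := hc c hcm
      rw [← h3]
      have key : ∀ i j : Fin 6, (i < j ∧ t2 i = true ∧ t2 j = false) →
        (i = 0 ∧ j = 2) ∨ (i = 0 ∧ j = 3) ∨ (i = 1 ∧ j = 2) ∨ (i = 1 ∧ j = 3) := by decide
      rcases key i j hij with ⟨rfl, rfl⟩ | ⟨rfl, rfl⟩ | ⟨rfl, rfl⟩ | ⟨rfl, rfl⟩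
      · exact Or.inr (Or.inl (mem_tet hc' (six_of (by decide) (by decide) (by decide) (by decide) (by decide) (by decide)) h1 h2))
      · exact Or.inl (Or.inr (mem_tet hc' (six_of (by decide) (by decide) (by decide) (by decide) (by decide) (by decide)) h1 h2))
      · exact Or.inr (Or.inr (mem_tet hc' (six_of (by decide) (by decide) (by decide) (by decide) (by decide) (by decide)) h1 h2))
      · exact Or.inl (Or.inl (mem_tet hc' (six_of (by decide) (by decide) (by decide) (by decide) (by decide) (by decide)) h1 h2))
    refine (measure_mono hsub).trans ((vol_bound1 (by positivity) (by positivity)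
      (vol_bound1 (by positivity) (by positivity) (vol_simC _ _ _ _).le (vol_simC _ _ _ _).le)
      (vol_bound1 (by positivity) (by positivity) (vol_simC _ _ _ _).le (vol_simC _ _ _ _).le)).trans
      (ENNReal.ofReal_le_ofReal ?_))
    have hh := abs_le.1 (hadamard (hp 5 4) (hp 1 0) (hp 3 2))
    have hid : D4 (p 4) (p 5) (p 0) (p 2) + D4 (p 4) (p 5) (p 2) (p 1) + D4 (p 4) (p 5) (p 1) (p 3) +
        D4 (p 4) (p 5) (p 3) (p 0) = - det3 (p 5 - p 4) (p 1 - p 0) (p 3 - p 2) ∨ 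
        D4 (p 4) (p 5) (p 0) (p 2) + D4 (p 4) (p 5) (p 2) (p 1) + D4 (p 4) (p 5) (p 1) (p 3) +
        D4 (p 4) (p 5) (p 3) (p 0) = det3 (p 5 - p 4) (p 1 - p 0) (p 3 - p 2) := by
      right; simp only [D4, det3, Pi.sub_apply]; ring
    rcases hs with ⟨s1, s2, s3, s4⟩ | ⟨s1, s2, s3, s4⟩
    · rw [abs_of_nonneg s1, abs_of_nonneg s2, abs_of_nonneg s3, abs_of_nonneg s4]
      rcases hid with hid | hid <;> linarith
    · rw [abs_of_nonpos s1, abs_of_nonpos s2, abs_of_nonpos s3, abs_of_nonpos s4]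
      rcases hid with hid | hid <;> linarith
  · have hsub : Hull p ⊆ (tmap (p 3) (p 4) (p 5) (p 0) '' simC ∪ tmap (p 3) (p 4) (p 5) (p 1) '' simC) := by
      rintro x ⟨c, hcm, rfl⟩
      obtain ⟨i, j, hij, c', hc', h1, h2, h3⟩ := hc c hcm
      rw [← h3]
      have key : ∀ i j : Fin 6, (i < j ∧ t3 i = true ∧ t3 j = false) →
        (i = 0 ∧ j = 2) ∨ (i = 1 ∧ j = 2) := by decide
      rcases key i j hij with ⟨rfl, rfl⟩ | ⟨rfl, rfl⟩
      · exact Or.inr (mem_tet hc' (six_of (by decide) (by decide) (by decide) (by decide) (by decide) (by decide)) h1 h2)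
      · exact Or.inl (mem_tet hc' (six_of (by decide) (by decide) (by decide) (by decide) (by decide) (by decide)) h1 h2)
    refine (measure_mono hsub).trans ((vol_bound1 (by positivity) (by positivity)
      (vol_simC _ _ _ _).le (vol_simC _ _ _ _).le).trans (ENNReal.ofReal_le_ofReal ?_))
    exact opp_bound hp hs
  · have hsub : Hull p ⊆ tmap (p 2) (p 3) (p 4) (p 5) '' simC := by
      rintro x ⟨c, hcm, rfl⟩
      obtain ⟨i, j, hij, c', hc', h1, h2, h3⟩ := hc c hcm
      rw [← h3]
      have key : ∀ i j : Fin 6, (i < j ∧ t4 i = true ∧ t4 j = false) → (i = 0 ∧ j = 1) := by decide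
      obtain ⟨rfl, rfl⟩ := key i j hij
      exact mem_tet hc' (six_of (by decide) (by decide) (by decide) (by decide) (by decide) (by decide)) h1 h2
    refine (measure_mono hsub).trans ((vol_simC _ _ _ _).le.trans (ENNReal.ofReal_le_ofReal ?_))
    have := hadamard (hp 3 2) (hp 4 2) (hp 5 2)
    simp only [D4]
    linarith
  · have hsub : Hull p ⊆ (tmap (p 3) (p 4) (p 5) (p 1) '' simC ∪ tmap (p 3) (p 4) (p 5) (p 2) '' simC) := by
      rintro x ⟨c, hcm, rfl⟩
      obtain ⟨i, j, hij, c', hc', h1, h2, h3⟩ := hc c hcm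
      rw [← h3]
      have key : ∀ i j : Fin 6, (i < j ∧ t5 i = true ∧ t5 j = false) →
        (i = 0 ∧ j = 1) ∨ (i = 0 ∧ j = 2) := by decide
      rcases key i j hij with ⟨rfl, rfl⟩ | ⟨rfl, rfl⟩
      · exact Or.inr (mem_tet hc' (six_of (by decide) (by decide) (by decide) (by decide) (by decide) (by decide)) h1 h2)
      · exact Or.inl (mem_tet hc' (six_of (by decide) (by decide) (by decide) (by decide) (by decide) (by decide)) h1 h2)
    refine (measure_mono hsub).trans ((vol_bound1 (by positivity) (by positivity)
      (vol_simC _ _ _ _).le (vol_simC _ _ _ _).le).trans (ENNReal.ofReal_le_ofReal ?_))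
    exact opp_bound hp hs

lemma vol_hull {p : Fin 6 → Fin 3 → ℝ} (hp : ∀ i j, dt (p i - p j) (p i - p j) ≤ 1) :
    volume (Hull p) ≤ ENNReal.ofReal (1959/10000) := by
  obtain ⟨σ, hσ⟩ := good_all p
  exact (measure_mono (hull_perm p σ)).trans (vol_hull_good (fun i j => hp (σ i) (σ j)) hσ)

lemma upper_aux (S : Finset (EuclideanSpace ℝ (Fin 3))) (hS : S.card = 6)
    (hd : Metric.diam (S : Set (EuclideanSpace ℝ (Fin 3))) ≤ 1) :
    volume (convexHull ℝ (S : Set (EuclideanSpace ℝ (Fin 3)))) ≤ ENNReal.ofReal (1959/10000) := by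
  let e : Fin 6 ≃ S := (S.equivFinOfCardEq hS).symm
  let p : Fin 6 → Fin 3 → ℝ := fun i => WithLp.ofLp (e i : EuclideanSpace ℝ (Fin 3))
  have hp : ∀ i j, dt (p i - p j) (p i - p j) ≤ 1 := by
    intro i j
    have h1 : dist (e i : EuclideanSpace ℝ (Fin 3)) (e j) ≤ 1 :=
      (Metric.dist_le_diam_of_mem S.finite_toSet.isBounded (e i).2 (e j).2).trans hd
    rw [EuclideanSpace.dist_eq, Real.sqrt_le_one, Fin.sum_univ_three] at h1
    simp only [Real.dist_eq, sq_abs] at h1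
    simp only [dt, p, Pi.sub_apply]
    linarith
  have hsub : convexHull ℝ (S : Set (EuclideanSpace ℝ (Fin 3))) ⊆
      (MeasurableEquiv.toLp 2 (Fin 3 → ℝ)).symm ⁻¹' Hull p := by
    intro x hx
    rw [Finset.mem_convexHull'] at hx
    obtain ⟨w, h0, h1, h2⟩ := hx
    have hsum : ∀ {M : Type} [AddCommMonoid M] (f : EuclideanSpace ℝ (Fin 3) → M),
        ∑ y ∈ S, f y = ∑ k, f (e k) := by
      intro M _ f
      rw [← Finset.sum_coe_sort S, ← Equiv.sum_comp e]
    refine ⟨fun k => w (e k), ⟨fun k => h0 _ (e k).2, ?_⟩, ?_⟩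
    · rw [← h1, hsum]
    · change WithLp.ofLp x = _
      rw [← h2, hsum (fun y => w y • y), WithLp.ofLp_sum]
      rfl
  refine (measure_mono hsub).trans ?_
  rw [(EuclideanSpace.volume_preserving_symm_measurableEquiv_toLp (Fin 3)).measure_preimage_equiv]
  exact vol_hull hp

/-- coordinates of the extremal-like example -/
noncomputable def ex : Fin 6 → Fin 3 → ℝ :=
  ![![-1/2, 222/1000, 0], ![-31/100, 808/1000, 0], ![31/100, 808/1000, 0], ![1/2, 222/1000, 0],
    ![0, 0, 1/2], ![0, 0, -1/2]]

lemma ex_dist : ∀ i j, dt (ex i - ex j) (ex i - ex j) ≤ 1 := by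
  intro i j
  fin_cases i <;> fin_cases j <;> simp [ex, dt] <;> norm_num

lemma ex_inj : Function.Injective ex := by
  intro i j h
  have h0 := congrFun h 0
  have h1 := congrFun h 1
  have h2 := congrFun h 2
  fin_cases i <;> fin_cases j <;> first | rfl | (exfalso; simp [ex] at h0 h1 h2 <;> linarith)

lemma tet_sub_hull {p : Fin 6 → Fin 3 → ℝ} {a b e d i j : Fin 6} (hs : Six a b e d i j)
    (had : a ≠ b ∧ a ≠ e ∧ a ≠ d ∧ b ≠ e ∧ b ≠ d ∧ e ≠ d) (hi : i ∉ ({a, b, e, d} : Finset (Fin 6)))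
    (hj : j ∉ ({a, b, e, d} : Finset (Fin 6))) :
    tmap (p a) (p b) (p e) (p d) '' simO ⊆ Hull p := by
  rintro x ⟨w, ⟨h0, h1⟩, rfl⟩
  rw [Fin.sum_univ_three] at h1
  obtain ⟨n1, n2, n3, n4, n5, n6⟩ := had
  simp only [Finset.mem_insert, Finset.mem_singleton, not_or] at hi hj
  obtain ⟨i1, i2, i3, i4⟩ := hi
  obtain ⟨j1, j2, j3, j4⟩ := hj
  let c : Fin 6 → ℝ := fun k => if k = a then 1 - w 0 - w 1 - w 2 else if k = b then w 0 else
    if k = e then w 1 else if k = d then w 2 else 0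
  have ca : c a = 1 - w 0 - w 1 - w 2 := by simp [c]
  have cb : c b = w 0 := by simp [c, n1.symm]
  have ce : c e = w 1 := by simp [c, n2.symm, n4.symm]
  have cd : c d = w 2 := by simp [c, n3.symm, n5.symm, n6.symm]
  have ci : c i = 0 := by simp [c, i1, i2, i3, i4]
  have cj : c j = 0 := by simp [c, j1, j2, j3, j4]
  refine ⟨c, ⟨?_, ?_⟩, ?_⟩
  · intro k
    have a0 := h0 0
    have a1 := h0 1
    have a2 := h0 2
    simp only [c]
    split_ifs <;> linarith
  · rw [hs, ca, cb, ce, cd, ci, cj]; ring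
  · ext m
    simp only [Finset.sum_apply, Pi.smul_apply, smul_eq_mul]
    rw [hs (fun k => c k * p k m), ca, cb, ce, cd, ci, cj]
    simp [tmap]
    ring

lemma ex_vol : ENNReal.ofReal (1952/10000) ≤ volume (Hull ex) := by
  let H1 : Set (Fin 3 → ℝ) := {x | 808/1000 * x 0 + 31/100 * x 1 < 0}
  let H2 : Set (Fin 3 → ℝ) := {x | 31/100 * x 1 - 808/1000 * x 0 < 0}
  have hH1 : ∀ x, x ∈ H1 ↔ 808/1000 * x 0 + 31/100 * x 1 < 0 := fun x => Iff.rfl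
  have hH2 : ∀ x, x ∈ H2 ↔ 31/100 * x 1 - 808/1000 * x 0 < 0 := fun x => Iff.rfl
  have hH1 : ∀ x, x ∈ H1 ↔ 808/1000 * x 0 + 31/100 * x 1 < 0 := fun x => Iff.rfl
  have hH2 : ∀ x, x ∈ H2 ↔ 31/100 * x 1 - 808/1000 * x 0 < 0 := fun x => Iff.rfl
  have m1 : MeasurableSet H1 := (isOpen_lt (by fun_prop) (by fun_prop)).measurableSet
  have m2 : MeasurableSet H2 := (isOpen_lt (by fun_prop) (by fun_prop)).measurableSet
  have A : tmap (ex 4) (ex 5) (ex 0) (ex 1) '' simO ⊆ Hull ex ∩ H1 := by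
    refine subset_inter (tet_sub_hull (i := 2) (j := 3) (six_of (by decide) (by decide) (by decide) (by decide) (by decide) (by decide))
      (by decide) (by decide) (by decide)) ?_
    rintro x ⟨w, ⟨h0, h1⟩, rfl⟩
    have a0 := h0 0
    have a1 := h0 1
    have a2 := h0 2
    simp only [hH1, hH2]
    simp [tmap, ex]
    linarith
  have B : tmap (ex 4) (ex 5) (ex 1) (ex 2) '' simO ⊆ (Hull ex \ H1) \ H2 := by
    intro x hx
    refine ⟨⟨tet_sub_hull (i := 0) (j := 3) (six_of (by decide) (by decide) (by decide) (by decide) (by decide) (by decide))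
      (by decide) (by decide) (by decide) hx, ?_⟩, ?_⟩
    all_goals
      obtain ⟨w, ⟨h0, h1⟩, rfl⟩ := hx
      have a0 := h0 0
      have a1 := h0 1
      have a2 := h0 2
      simp only [hH1, hH2, not_lt]
      simp [tmap, ex]
      linarith
  have C : tmap (ex 4) (ex 5) (ex 2) (ex 3) '' simO ⊆ (Hull ex \ H1) ∩ H2 := by
    intro x hx
    refine ⟨⟨tet_sub_hull (i := 0) (j := 1) (six_of (by decide) (by decide) (by decide) (by decide) (by decide) (by decide))
      (by decide) (by decide) (by decide) hx, ?_⟩, ?_⟩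
    · obtain ⟨w, ⟨h0, h1⟩, rfl⟩ := hx
      have a0 := h0 0
      have a1 := h0 1
      have a2 := h0 2
      simp only [hH1, hH2, not_lt]
      simp [tmap, ex]
      linarith
    · obtain ⟨w, ⟨h0, h1⟩, rfl⟩ := hx
      have a0 := h0 0
      have a1 := h0 1
      have a2 := h0 2
      simp only [hH1, hH2]
      simp [tmap, ex]
      linarith
  rw [← measure_inter_add_sdiff (Hull ex) m1, ← measure_inter_add_sdiff (Hull ex \ H1) m2]
  have vA := measure_mono (μ := volume) A
  have vB := measure_mono (μ := volume) B
  have vC := measure_mono (μ := volume) C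
  rw [vol_simO] at vA vB vC
  refine le_trans ?_ (add_le_add vA (add_le_add vC vB))
  rw [← ENNReal.ofReal_add (by positivity) (by positivity), ← ENNReal.ofReal_add (by positivity) (by positivity)]
  apply ENNReal.ofReal_le_ofReal
  have q1 : |D4 (ex 4) (ex 5) (ex 0) (ex 1)| = 33518/100000 := by
    rw [abs_eq (by norm_num)]; simp [D4, det3, ex]; norm_num
  have q2 : |D4 (ex 4) (ex 5) (ex 1) (ex 2)| = 50096/100000 := by
    rw [abs_eq (by norm_num)]; simp [D4, det3, ex]; norm_num
  have q3 : |D4 (ex 4) (ex 5) (ex 2) (ex 3)| = 33518/100000 := by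
    rw [abs_eq (by norm_num)]; simp [D4, det3, ex]; norm_num
  rw [q1, q2, q3]
  norm_num

lemma lower_aux : ∃ S : Finset (EuclideanSpace ℝ (Fin 3)), S.card = 6 ∧
    Metric.diam (S : Set (EuclideanSpace ℝ (Fin 3))) ≤ 1 ∧
    ENNReal.ofReal (1952/10000) ≤ volume (convexHull ℝ (S : Set (EuclideanSpace ℝ (Fin 3)))) := by
  let q : Fin 6 → EuclideanSpace ℝ (Fin 3) := fun i => WithLp.toLp 2 (ex i)
  have hq : Function.Injective q := fun i j h => ex_inj (WithLp.toLp_injective 2 h)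
  refine ⟨Finset.univ.image q, ?_, ?_, ?_⟩
  · rw [Finset.card_image_of_injective _ hq]; rfl
  · apply Metric.diam_le_of_forall_dist_le zero_le_one
    intro x hx y hy
    simp only [Finset.coe_image, Finset.coe_univ, image_univ, mem_range] at hx hy
    obtain ⟨i, rfl⟩ := hx
    obtain ⟨j, rfl⟩ := hy
    rw [EuclideanSpace.dist_eq, Real.sqrt_le_one, Fin.sum_univ_three]
    simp only [Real.dist_eq, sq_abs]
    have := ex_dist i j
    simp only [dt, Pi.sub_apply] at this
    simp only [q]
    linarith
  · have hsub : (MeasurableEquiv.toLp 2 (Fin 3 → ℝ)).symm ⁻¹' Hull ex ⊆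
        convexHull ℝ ((Finset.univ.image q : Finset _) : Set (EuclideanSpace ℝ (Fin 3))) := by
      rintro x ⟨c, ⟨h0, h1⟩, hx⟩
      refine mem_convexHull_of_exists_fintype c q h0 h1 (fun i => by simp) ?_
      apply WithLp.ofLp_injective 2
      change _ = (MeasurableEquiv.toLp 2 (Fin 3 → ℝ)).symm x
      rw [hx, WithLp.ofLp_sum]
      rfl
    refine ex_vol.trans (le_trans (le_of_eq ?_) (measure_mono hsub))
    rw [(EuclideanSpace.volume_preserving_symm_measurableEquiv_toLp (Fin 3)).measure_preimage_equiv]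

theorem stmt_15 : 0.195 < polyVol 3 6 ∧ polyVol 3 6 < 0.196 := by
  have hub : ∀ v ∈ {v : ℝ | ∃ S : Finset (EuclideanSpace ℝ (Fin 3)),
    S.card = 6 ∧ Metric.diam (S : Set (EuclideanSpace ℝ (Fin 3))) ≤ 1 ∧
    v = (volume (convexHull ℝ (S : Set (EuclideanSpace ℝ (Fin 3))))).toReal}, v ≤ 1959/10000 := by
    rintro v ⟨S, h1, h2, rfl⟩
    exact ENNReal.toReal_le_of_le_ofReal (by norm_num) (upper_aux S h1 h2)
  obtain ⟨S, h1, h2, h3⟩ := lower_aux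
  have hmem : (volume (convexHull ℝ (S : Set (EuclideanSpace ℝ (Fin 3))))).toReal ∈
    {v : ℝ | ∃ S : Finset (EuclideanSpace ℝ (Fin 3)),
    S.card = 6 ∧ Metric.diam (S : Set (EuclideanSpace ℝ (Fin 3))) ≤ 1 ∧
    v = (volume (convexHull ℝ (S : Set (EuclideanSpace ℝ (Fin 3))))).toReal} := ⟨S, h1, h2, rfl⟩
  have hlow : 1952/10000 ≤ (volume (convexHull ℝ (S : Set (EuclideanSpace ℝ (Fin 3))))).toReal := by
    rw [← ENNReal.ofReal_le_iff_le_toReal]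
    · exact h3
    · exact ne_top_of_le_ne_top ENNReal.ofReal_ne_top (upper_aux S h1 h2)
  constructor
  · have := le_csSup (⟨_, hub⟩ : BddAbove _) hmem
    unfold polyVol
    have h4 := hlow.trans this
    refine lt_of_lt_of_le ?_ h4
    norm_num
  · unfold polyVol
    refine lt_of_le_of_lt (csSup_le ⟨_, hmem⟩ hub) ?_
    norm_num
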